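/- arXiv:2202.07243 — 3 statements merged into one kernel-verified Lean document; each statement's English description precedes it below -/
import Mathlib

section
/- Let p be an odd prime and let G̃ be the group presented by generators x₁, x₂, y₁, y₂, z₁, z₂, v₁, v₂, u₁, u₂ and relations: [y₁,x₁]=z₁, [y₁,x₂]=z₂, [y₂,x₁]=z₂, [z₁,x₁]=v₁, [z₁,x₂]=v₂, [z₁,y₁]=u₁, [z₁,y₂]=u₂, [z₂,x₁]=v₂, [z₂,y₁]=u₂, x₁ᵖ=x₂ᵖ=y₁ᵖ=y₂ᵖ=z₁ᵖ=z₂ᵖ=1, together with the relations declaring trivial every commutator of two generators not determined by the above (in particular [x₂,x₁]=[y₂,y₁]=[y₂,x₂]=[z₂,x₂]=[z₂,y₂]=[z₁,z₂]=1 and v₁,v₂,u₁,u₂ are central). Then G̃ has order p¹⁰. -/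
namespace Stmt9

/-- Generators of the presented group `G̃`. -/
inductive Gen
  | x1 | x2 | y1 | y2 | z1 | z2 | v1 | v2 | u1 | u2
  deriving DecidableEq

open Gen FreeGroup

/-- The commutator `[a,b] = a⁻¹b⁻¹ab`. -/
def comm (a b : FreeGroup Gen) : FreeGroup Gen := a⁻¹ * b⁻¹ * a * b

/-- The ordered pairs of generators whose commutator is specified by one of the listed
(possibly nontrivial) relations. -/
def specified : List (Gen × Gen) :=
  [(y1, x1), (y1, x2), (y2, x1),
   (z1, x1), (z1, x2), (z1, y1), (z1, y2), (z2, x1), (z2, y1)]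

/-- The relators of `G̃`: the listed commutator relations, `p`-th power relations for
`x₁, x₂, y₁, y₂, z₁, z₂`, and trivial commutator relations for every pair of generators
whose commutator is not determined by the listed relations. -/
def rels (p : ℕ) : Set (FreeGroup Gen) :=
  ({comm (of y1) (of x1) * (of z1)⁻¹,
    comm (of y1) (of x2) * (of z2)⁻¹,
    comm (of y2) (of x1) * (of z2)⁻¹,
    comm (of z1) (of x1) * (of v1)⁻¹,
    comm (of z1) (of x2) * (of v2)⁻¹,
    comm (of z1) (of y1) * (of u1)⁻¹,
    comm (of z1) (of y2) * (of u2)⁻¹,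
    comm (of z2) (of x1) * (of v2)⁻¹,
    comm (of z2) (of y1) * (of u2)⁻¹} : Set (FreeGroup Gen)) ∪
  {r | ∃ g h : Gen, r = comm (of g) (of h) ∧ (g, h) ∉ specified ∧ (h, g) ∉ specified} ∪
  ({of x1 ^ p, of x2 ^ p, of y1 ^ p, of y2 ^ p, of z1 ^ p, of z2 ^ p} :
    Set (FreeGroup Gen))

/-- The group `G̃` presented by the generators and relations above. -/
abbrev Gtilde (p : ℕ) := PresentedGroup (rels p)

section CommutingGenerators

variable {G ι : Type*} [Group G] [Fintype ι]

/-- A subgroup generated by finitely many pairwise commuting elements of exponent `n` has at most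
`n ^ card ι` elements. -/
theorem finite_and_card_closure_range_le {n : ℕ} (hn : 0 < n) (f : ι → G)
    (hf : ∀ i, f i ^ n = 1) (hcomm : ∀ i j, Commute (f i) (f j)) :
    Finite (Subgroup.closure (Set.range f)) ∧
      Nat.card (Subgroup.closure (Set.range f)) ≤ n ^ Fintype.card ι := by
  have hfin : ∀ i, Finite (Subgroup.zpowers (f i)) := fun i =>
    isOfFinOrder_iff_pow_eq_one.2 ⟨n, hn, hf i⟩ |>.finite_zpowers
  let φ : (∀ i, Subgroup.zpowers (f i)) →* G :=
    MonoidHom.noncommPiCoprod (fun i => (Subgroup.zpowers (f i)).subtype) (by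
      rintro i j - ⟨_, a, rfl⟩ ⟨_, b, rfl⟩
      exact ((hcomm i j).zpow_left a).zpow_right b)
  have hφ : φ.range = Subgroup.closure (Set.range f) := by
    refine (MonoidHom.noncommPiCoprod_range _).trans ?_
    simp only [Subgroup.range_subtype, Subgroup.zpowers_eq_closure, ← Subgroup.closure_iUnion,
      Set.iUnion_singleton_eq_range]
  rw [← hφ]
  refine ⟨Finite.of_surjective _ φ.rangeRestrict_surjective,
    (Nat.card_le_card_of_surjective _ φ.rangeRestrict_surjective).trans ?_⟩
  rw [Nat.card_pi, ← Finset.card_univ, ← Finset.prod_const]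
  refine Finset.prod_le_prod' fun i _ => ?_
  rw [Nat.card_zpowers]
  exact orderOf_le_of_pow_eq_one hn (hf i)

end CommutingGenerators

/-- If the commutator `c` of `a` and `b` commutes with `a`, then it satisfies every power relation
satisfied by `a`. -/
theorem pow_eq_one_of_mul_eq {G : Type*} [Group G] {a b c : G} {n : ℕ} (h : a * b = b * a * c)
    (hac : Commute a c) (ha : a ^ n = 1) : c ^ n = 1 := by
  have hconj : a * c = b⁻¹ * a * b⁻¹⁻¹ := by
    rw [inv_inv, mul_assoc, h]; group
  have : (a * c) ^ n = 1 := by rw [hconj, conj_pow, ha]; group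
  rwa [hac.mul_pow, ha, one_mul] at this

/-- The normal form `x₁ᵃ x₂ᵇ y₁ᶜ y₂ᵈ z₁ᵉ z₂ᶠ v₁ᵍ v₂ʰ u₁ⁱ u₂ʲ`, except that `g`, `h`, `i`, `j`
are stored doubled, so that the multiplication is polynomial with integral coefficients. -/
@[ext]
structure NormalForm (R : Type*) where
  (a b c d e f g h i j : R)

namespace NormalForm

variable {R : Type*} [CommRing R]

instance : One (NormalForm R) := ⟨⟨0, 0, 0, 0, 0, 0, 0, 0, 0, 0⟩⟩

instance : Mul (NormalForm R) := ⟨fun s t =>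
  { a := s.a + t.a
    b := s.b + t.b
    c := s.c + t.c
    d := s.d + t.d
    e := s.e + t.e + t.a * s.c
    f := s.f + t.f + t.b * s.c + t.a * s.d
    g := s.g + t.g + 2 * s.e * t.a + s.c * (t.a ^ 2 - t.a)
    h := s.h + t.h + 2 * s.e * t.b + 2 * s.f * t.a + s.d * (t.a ^ 2 - t.a)
      + 2 * s.c * t.a * t.b
    i := s.i + t.i + t.a * (s.c ^ 2 - s.c) + 2 * (t.a * s.c + s.e) * t.c
    j := s.j + t.j + t.b * (s.c ^ 2 - s.c) + 2 * t.a * s.c * s.d + 2 * (t.a * s.c + s.e) * t.d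
      + 2 * (t.b * s.c + t.a * s.d + s.f) * t.c }⟩

instance : Inv (NormalForm R) := ⟨fun s =>
  { a := -s.a
    b := -s.b
    c := -s.c
    d := -s.d
    e := -s.e + s.a * s.c
    f := -s.f + s.b * s.c + s.a * s.d
    g := -s.g - 2 * (-s.e + s.a * s.c) * s.a + s.c * (s.a ^ 2 - s.a)
    h := -s.h - 2 * (-s.e + s.a * s.c) * s.b - 2 * (-s.f + s.b * s.c + s.a * s.d) * s.a
      + s.d * (s.a ^ 2 - s.a) + 2 * s.c * s.a * s.b
    i := -s.i - s.a * (s.c ^ 2 + s.c) + 2 * s.e * s.c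
    j := -s.j - s.b * (s.c ^ 2 + s.c) - 2 * s.a * s.c * s.d + 2 * s.e * s.d + 2 * s.f * s.c }⟩

theorem one_def : (1 : NormalForm R) = ⟨0, 0, 0, 0, 0, 0, 0, 0, 0, 0⟩ := rfl

theorem mul_def (s t : NormalForm R) : s * t =
  { a := s.a + t.a
    b := s.b + t.b
    c := s.c + t.c
    d := s.d + t.d
    e := s.e + t.e + t.a * s.c
    f := s.f + t.f + t.b * s.c + t.a * s.d
    g := s.g + t.g + 2 * s.e * t.a + s.c * (t.a ^ 2 - t.a)
    h := s.h + t.h + 2 * s.e * t.b + 2 * s.f * t.a + s.d * (t.a ^ 2 - t.a)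
      + 2 * s.c * t.a * t.b
    i := s.i + t.i + t.a * (s.c ^ 2 - s.c) + 2 * (t.a * s.c + s.e) * t.c
    j := s.j + t.j + t.b * (s.c ^ 2 - s.c) + 2 * t.a * s.c * s.d + 2 * (t.a * s.c + s.e) * t.d
      + 2 * (t.b * s.c + t.a * s.d + s.f) * t.c } := rfl

instance : Group (NormalForm R) := Group.ofLeftAxioms
  (fun r s t => by
    ext <;> simp only [mul_def] <;> ring)
  (fun s => by
    ext <;> simp only [mul_def, one_def] <;> ring)
  (fun s => by
    ext <;> simp only [mul_def, one_def, Inv.inv] <;> ring)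

/-- The `t`-th power of a generator. -/
def powGen (t : R) : Gen → NormalForm R
  | x1 => ⟨t, 0, 0, 0, 0, 0, 0, 0, 0, 0⟩
  | x2 => ⟨0, t, 0, 0, 0, 0, 0, 0, 0, 0⟩
  | y1 => ⟨0, 0, t, 0, 0, 0, 0, 0, 0, 0⟩
  | y2 => ⟨0, 0, 0, t, 0, 0, 0, 0, 0, 0⟩
  | z1 => ⟨0, 0, 0, 0, t, 0, 0, 0, 0, 0⟩
  | z2 => ⟨0, 0, 0, 0, 0, t, 0, 0, 0, 0⟩
  | v1 => ⟨0, 0, 0, 0, 0, 0, 2 * t, 0, 0, 0⟩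
  | v2 => ⟨0, 0, 0, 0, 0, 0, 0, 2 * t, 0, 0⟩
  | u1 => ⟨0, 0, 0, 0, 0, 0, 0, 0, 2 * t, 0⟩
  | u2 => ⟨0, 0, 0, 0, 0, 0, 0, 0, 0, 2 * t⟩

theorem powGen_zero (g : Gen) : powGen (0 : R) g = 1 := by
  cases g <;> simp [powGen, one_def]

theorem powGen_one_pow (g : Gen) (n : ℕ) : powGen (1 : R) g ^ n = powGen (n : R) g := by
  induction n with
  | zero => rw [pow_zero, Nat.cast_zero, powGen_zero]
  | succ n ih =>
    rw [pow_succ, ih]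
    cases g <;> simp [powGen, mul_def, mul_add]

theorem lift_comm_mul_inv {G : Type*} [Group G] (f : Gen → G) {a b c : Gen}
    (h : f a * f b = f b * f a * f c) :
    FreeGroup.lift f (comm (of a) (of b) * (of c)⁻¹) = 1 := by
  simp only [comm, _root_.map_mul, _root_.map_inv, FreeGroup.lift_apply_of]
  rw [mul_assoc _ (f a), h]
  group

theorem lift_rels (p : ℕ) : ∀ r ∈ rels p, FreeGroup.lift (powGen (1 : ZMod p)) r = 1 := by
  rintro r ((h | ⟨g, h, rfl, hgh, hhg⟩) | h)
  · simp only [Set.mem_insert_iff, Set.mem_singleton_iff] at h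
    rcases h with rfl | rfl | rfl | rfl | rfl | rfl | rfl | rfl | rfl <;>
      refine lift_comm_mul_inv _ ?_ <;> simp [powGen, mul_def]
  · have hcomm : powGen (1 : ZMod p) g * powGen 1 h = powGen 1 h * powGen 1 g := by
      cases g <;> cases h <;> simp [specified] at hgh hhg <;> simp [powGen, mul_def]
    simp only [comm, _root_.map_mul, _root_.map_inv, FreeGroup.lift_apply_of]
    rw [mul_assoc _ (powGen 1 g), hcomm]
    group
  · simp only [Set.mem_insert_iff, Set.mem_singleton_iff] at h
    rcases h with rfl | rfl | rfl | rfl | rfl | rfl <;>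
      rw [_root_.map_pow, FreeGroup.lift_apply_of, powGen_one_pow, ZMod.natCast_self, powGen_zero]

theorem natCard (p : ℕ) : Nat.card (NormalForm (ZMod p)) = p ^ 10 := by
  let φ : NormalForm (ZMod p) ≃ (Fin 10 → ZMod p) :=
    { toFun s := ![s.a, s.b, s.c, s.d, s.e, s.f, s.g, s.h, s.i, s.j]
      invFun t := ⟨t 0, t 1, t 2, t 3, t 4, t 5, t 6, t 7, t 8, t 9⟩
      left_inv _ := rfl
      right_inv t := by ext i; fin_cases i <;> rfl }
  rw [Nat.card_congr φ, Nat.card_fun, Nat.card_zmod, Nat.card_fin]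

theorem toGroup_surjective {p : ℕ} (hp : p ≠ 0) (hodd : Odd p) :
    Function.Surjective (PresentedGroup.toGroup (lift_rels p)) := by
  have : NeZero p := ⟨hp⟩
  rw [← MonoidHom.range_eq_top, eq_top_iff]
  rintro s -
  set K := (PresentedGroup.toGroup (lift_rels p)).range
  have hK (t : ZMod p) (g : Gen) : powGen t g ∈ K := by
    rw [← ZMod.natCast_zmod_val t, ← powGen_one_pow]
    exact pow_mem (MonoidHom.mem_range.2 ⟨PresentedGroup.of g, PresentedGroup.toGroup.of _⟩) _
  obtain ⟨k, hk⟩ : ∃ k : ZMod p, 2 * k = 1 := by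
    have h := ZMod.coe_mul_inv_eq_one 2 (Nat.coprime_two_left.2 hodd)
    exact ⟨(2 : ℕ)⁻¹, by exact_mod_cast h⟩
  have hs : s = powGen s.a x1 * powGen s.b x2 * powGen s.c y1 * powGen s.d y2 * powGen s.e z1
      * powGen s.f z2 * powGen (k * s.g) v1 * powGen (k * s.h) v2 * powGen (k * s.i) u1
      * powGen (k * s.j) u2 := by
    ext <;> simp [powGen, mul_def, ← mul_assoc, hk]
  rw [hs]
  iterate 9 refine mul_mem ?_ (hK _ _)
  exact hK _ _

end NormalForm

namespace Gtilde

variable {p : ℕ}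

/-- The image of a generator in `G̃`. -/
def gen (p : ℕ) (g : Gen) : Gtilde p := PresentedGroup.of g

theorem mul_eq_of_mem_rels {a b c : Gen} (h : comm (of a) (of b) * (of c)⁻¹ ∈ rels p) :
    gen p a * gen p b = gen p b * gen p a * gen p c := by
  have h1 : (gen p a)⁻¹ * (gen p b)⁻¹ * gen p a * gen p b * (gen p c)⁻¹ = 1 :=
    PresentedGroup.one_of_mem h
  rw [mul_inv_eq_one] at h1
  rw [← h1]
  group

theorem commute_gen {a b : Gen} (hab : (a, b) ∉ specified) (hba : (b, a) ∉ specified) :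
    Commute (gen p a) (gen p b) := by
  have h1 : (gen p a)⁻¹ * (gen p b)⁻¹ * gen p a * gen p b = 1 :=
    PresentedGroup.one_of_mem (rels := rels p) (Or.inl (Or.inr ⟨a, b, rfl, hab, hba⟩))
  calc gen p a * gen p b
      = gen p b * gen p a * ((gen p a)⁻¹ * (gen p b)⁻¹ * gen p a * gen p b) := by group
    _ = gen p b * gen p a := by rw [h1, mul_one]

theorem closure_range_gen : Subgroup.closure (Set.range (gen p)) = ⊤ :=
  PresentedGroup.closure_range_of _

/-- The generators of the derived subgroup. -/
def low : Fin 6 → Gen := ![z1, z2, v1, v2, u1, u2]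

/-- The generators of the abelianization. -/
def top : Fin 4 → Gen := ![x1, x2, y1, y2]

theorem exists_low_or_top (g : Gen) : (∃ i, low i = g) ∨ ∃ i, top i = g := by
  cases g <;> decide

theorem gen_low_pow (i : Fin 6) : gen p (low i) ^ p = 1 := by
  have hz1 : gen p z1 ^ p = 1 :=
    PresentedGroup.one_of_mem (rels := rels p) (by simp [rels])
  have hz2 : gen p z2 ^ p = 1 :=
    PresentedGroup.one_of_mem (rels := rels p) (by simp [rels])
  fin_cases i
  · exact hz1
  · exact hz2
  · exact pow_eq_one_of_mul_eq (mul_eq_of_mem_rels (a := z1) (b := x1) (c := v1) (by simp [rels]))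
      (commute_gen (by decide) (by decide)) hz1
  · exact pow_eq_one_of_mul_eq (mul_eq_of_mem_rels (a := z1) (b := x2) (c := v2) (by simp [rels]))
      (commute_gen (by decide) (by decide)) hz1
  · exact pow_eq_one_of_mul_eq (mul_eq_of_mem_rels (a := z1) (b := y1) (c := u1) (by simp [rels]))
      (commute_gen (by decide) (by decide)) hz1
  · exact pow_eq_one_of_mul_eq (mul_eq_of_mem_rels (a := z1) (b := y2) (c := u2) (by simp [rels]))
      (commute_gen (by decide) (by decide)) hz1

theorem gen_top_pow (i : Fin 4) : gen p (top i) ^ p = 1 := by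
  refine PresentedGroup.one_of_mem (rels := rels p) ?_
  fin_cases i <;> simp [rels, top]

theorem commute_gen_low (i j : Fin 6) : Commute (gen p (low i)) (gen p (low j)) :=
  commute_gen (by revert i j; decide) (by revert i j; decide)

/-- The derived subgroup of `G̃`, by generators. -/
def lower (p : ℕ) : Subgroup (Gtilde p) := Subgroup.closure (Set.range fun i => gen p (low i))

theorem gen_low_mem (i : Fin 6) : gen p (low i) ∈ lower p :=
  Subgroup.subset_closure ⟨i, rfl⟩

theorem specified_commutator {a b : Gen} (h : (a, b) ∈ specified) :
    ∃ i, gen p a * gen p b = gen p b * gen p a * gen p (low i) ∧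
      ((∃ j, low j = a) → Commute (gen p b) (gen p (low i))) := by
  simp only [specified, List.mem_cons, Prod.mk.injEq, List.not_mem_nil, or_false] at h
  rcases h with ⟨rfl, rfl⟩ | ⟨rfl, rfl⟩ | ⟨rfl, rfl⟩ | ⟨rfl, rfl⟩ | ⟨rfl, rfl⟩ | ⟨rfl, rfl⟩ |
    ⟨rfl, rfl⟩ | ⟨rfl, rfl⟩ | ⟨rfl, rfl⟩
  · exact ⟨0, mul_eq_of_mem_rels (by simp [rels, low]), fun h => absurd h (by decide)⟩
  · exact ⟨1, mul_eq_of_mem_rels (by simp [rels, low]), fun h => absurd h (by decide)⟩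
  · exact ⟨1, mul_eq_of_mem_rels (by simp [rels, low]), fun h => absurd h (by decide)⟩
  · exact ⟨2, mul_eq_of_mem_rels (by simp [rels, low]),
      fun _ => commute_gen (by decide) (by decide)⟩
  · exact ⟨3, mul_eq_of_mem_rels (by simp [rels, low]),
      fun _ => commute_gen (by decide) (by decide)⟩
  · exact ⟨4, mul_eq_of_mem_rels (by simp [rels, low]),
      fun _ => commute_gen (by decide) (by decide)⟩
  · exact ⟨5, mul_eq_of_mem_rels (by simp [rels, low]),
      fun _ => commute_gen (by decide) (by decide)⟩
  · exact ⟨3, mul_eq_of_mem_rels (by simp [rels, low]),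
      fun _ => commute_gen (by decide) (by decide)⟩
  · exact ⟨5, mul_eq_of_mem_rels (by simp [rels, low]),
      fun _ => commute_gen (by decide) (by decide)⟩

theorem exists_commutator_low (g : Gen) (i : Fin 6) :
    ∃ c ∈ lower p, Commute (gen p g) c ∧ gen p (low i) * gen p g = gen p g * gen p (low i) * c := by
  by_cases h : (low i, g) ∈ specified
  · obtain ⟨j, hj, hc⟩ := specified_commutator (p := p) h
    exact ⟨_, gen_low_mem j, hc ⟨i, rfl⟩, hj⟩
  · by_cases h' : (g, low i) ∈ specified
    · refine absurd h' ?_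
      clear h h'
      revert i
      cases g <;> decide
    · exact ⟨1, one_mem _, Commute.one_right _, by rw [mul_one]; exact commute_gen h h'⟩

instance normal_lower : (lower p).Normal := by
  rw [← Subgroup.normalizer_eq_top_iff, eq_top_iff, ← closure_range_gen, Subgroup.closure_le]
  rintro _ ⟨g, rfl⟩
  have h1 : lower p ≤ (lower p).comap (MulAut.conj (gen p g)).toMonoidHom := by
    refine (Subgroup.closure_le _).2 ?_
    rintro _ ⟨i, rfl⟩
    obtain ⟨c, hc, hgc, h⟩ := exists_commutator_low (p := p) g i
    have : gen p g * gen p (low i) * (gen p g)⁻¹ = gen p (low i) * c⁻¹ := by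
      rw [mul_inv_eq_iff_eq_mul, mul_assoc, ← hgc.inv_right.eq, ← mul_assoc, h, mul_inv_cancel_right]
    change gen p g * gen p (low i) * (gen p g)⁻¹ ∈ lower p
    exact this ▸ mul_mem (gen_low_mem i) (inv_mem hc)
  have h2 : lower p ≤ (lower p).comap (MulAut.conj (gen p g)⁻¹).toMonoidHom := by
    refine (Subgroup.closure_le _).2 ?_
    rintro _ ⟨i, rfl⟩
    obtain ⟨c, hc, hgc, h⟩ := exists_commutator_low (p := p) g i
    have : (gen p g)⁻¹ * gen p (low i) * (gen p g)⁻¹⁻¹ = gen p (low i) * c := by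
      rw [inv_inv, mul_assoc, h]; group
    change (gen p g)⁻¹ * gen p (low i) * (gen p g)⁻¹⁻¹ ∈ lower p
    exact this ▸ mul_mem (gen_low_mem i) hc
  refine Subgroup.mem_normalizer_iff.2 fun m => ⟨fun hm => h1 hm, fun hm => ?_⟩
  have h3 : (gen p g)⁻¹ * (gen p g * m * (gen p g)⁻¹) * (gen p g)⁻¹⁻¹ ∈ lower p := h2 hm
  simpa [mul_assoc] using h3

/-- The image of `gen` in the quotient by the derived subgroup. -/
def quotGen (p : ℕ) (g : Gen) : Gtilde p ⧸ lower p := QuotientGroup.mk' (lower p) (gen p g)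

theorem quotGen_low (i : Fin 6) : quotGen p (low i) = 1 :=
  (QuotientGroup.eq_one_iff _).2 (gen_low_mem i)

theorem commute_quotGen (a b : Gen) : Commute (quotGen p a) (quotGen p b) := by
  have key {a b : Gen} (h : (a, b) ∈ specified) : Commute (quotGen p a) (quotGen p b) := by
    obtain ⟨i, hi, -⟩ := specified_commutator (p := p) h
    have := congrArg (QuotientGroup.mk' (lower p)) hi
    simp only [_root_.map_mul] at this
    change quotGen p a * quotGen p b = quotGen p b * quotGen p a * quotGen p (low i) at this
    rwa [quotGen_low, mul_one] at this
  by_cases h : (a, b) ∈ specified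
  · exact key h
  by_cases h' : (b, a) ∈ specified
  · exact (key h').symm
  exact (commute_gen h h').map (QuotientGroup.mk' (lower p))

theorem closure_range_quotGen_top :
    Subgroup.closure (Set.range fun i => quotGen p (top i)) = ⊤ := by
  rw [eq_top_iff, ← MonoidHom.range_eq_top.2 (QuotientGroup.mk'_surjective (lower p)),
    MonoidHom.range_eq_map, ← closure_range_gen, MonoidHom.map_closure, Subgroup.closure_le]
  rintro _ ⟨_, ⟨g, rfl⟩, rfl⟩
  change quotGen p g ∈ _
  obtain ⟨i, rfl⟩ | ⟨i, rfl⟩ := exists_low_or_top g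
  · rw [quotGen_low]
    exact one_mem _
  · exact Subgroup.subset_closure ⟨i, rfl⟩

theorem finite_and_card_le (hp : 0 < p) : Finite (Gtilde p) ∧ Nat.card (Gtilde p) ≤ p ^ 10 := by
  obtain ⟨hfin, hcard⟩ : Finite (lower p) ∧ Nat.card (lower p) ≤ _ :=
    finite_and_card_closure_range_le hp _ (gen_low_pow (p := p)) commute_gen_low
  obtain ⟨hfin', hcard'⟩ := finite_and_card_closure_range_le hp (fun i => quotGen p (top i))
    (fun i => by rw [quotGen, ← _root_.map_pow, gen_top_pow, _root_.map_one]) (fun _ _ => commute_quotGen _ _)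
  rw [closure_range_quotGen_top] at hfin' hcard'
  rw [Subgroup.card_top] at hcard'
  have : Finite (Gtilde p ⧸ lower p) := Finite.of_equiv _ Subgroup.topEquiv.toEquiv
  refine ⟨(finite_iff_subgroup_quotient (lower p)).2 ⟨hfin, this⟩, ?_⟩
  rw [Subgroup.card_eq_card_quotient_mul_card_subgroup (lower p)]
  refine (Nat.mul_le_mul hcard' hcard).trans_eq ?_
  rw [← pow_add, Fintype.card_fin, Fintype.card_fin]

end Gtilde

/-- For an odd prime `p`, the presented group `G̃` has order `p¹⁰`. -/
theorem card_Gtilde (p : ℕ) (hp : p.Prime) (hodd : Odd p) :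
    Nat.card (Gtilde p) = p ^ 10 := by
  obtain ⟨hfin, hle⟩ := Gtilde.finite_and_card_le hp.pos
  refine le_antisymm hle ?_
  rw [← NormalForm.natCard p]
  exact Nat.card_le_card_of_surjective _ (NormalForm.toGroup_surjective hp.ne_zero hodd)

end Stmt9
end

section
/- Let p be an odd prime and let k ∈ 𝔽_p be a non-square in 𝔽_pˣ (so that t² − k is irreducible over 𝔽_p and 𝔽_p[t]/(t²−k) ≅ 𝔽_{p²}). Let G* be the group presented by generators x₁, x₂, y₁, y₂, z₁, z₂, w₁, w₂, w₃, w₄, v₁, v₂, u₁, u₂ and relations: [y₁,x₁]=z₁, [y₁,x₂]=z₂, [y₂,x₁]=z₂w₂, [y₂,x₂]=z₁ᵏw₃, [x₂,x₁]=w₁, [y₂,y₁]=w₄, [z₁,x₁]=v₁, [z₁,x₂]=v₂, [z₁,y₁]=u₁, [z₁,y₂]=u₂, [z₂,x₁]=v₂, [z₂,y₁]=u₂, [z₂,x₂]=v₁ᵏ, [z₂,y₂]=u₁ᵏ, x₁ᵖ=x₂ᵖ=y₁ᵖ=y₂ᵖ=z₁ᵖ=z₂ᵖ=w₁ᵖ=w₂ᵖ=w₃ᵖ=w₄ᵖ=1,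 together with the relations declaring trivial every commutator of two generators not determined by the above (in particular w₁,w₂,w₃,w₄,u₁,u₂,v₁,v₂ are central and [z₁,z₂]=1). Then G* has order p¹⁴; the subgroup A generated by w₁,w₂,w₃,w₄,u₁,u₂,v₁,v₂ is contained in Z(G*) ∩ [G*,G*], is isomorphic to (ℤ/pℤ)⁸, and G*/A ≅ H₃(𝔽_p[t]/(t²−k)). Hence G* is a representation group of H₃(𝔽_{p²}). -/
open Polynomial

/-- The Heisenberg group `H₃(R)` of 3×3 upper unitriangular matrices over a commutative
ring `R`.  An element is determined by its entries: `b` is the (1,2)-entry, `a` is the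
(2,3)-entry and `c` is the (1,3)-entry; multiplication is matrix multiplication. -/
@[ext]
structure Heisenberg (R : Type*) [CommRing R] where
  a : R
  b : R
  c : R

namespace Heisenberg

variable {R : Type*} [CommRing R]

instance : Mul (Heisenberg R) :=
  ⟨fun x y => ⟨x.a + y.a, x.b + y.b, x.c + y.c + x.b * y.a⟩⟩

instance : One (Heisenberg R) := ⟨⟨0, 0, 0⟩⟩

instance : Inv (Heisenberg R) := ⟨fun x => ⟨-x.a, -x.b, -x.c + x.b * x.a⟩⟩

@[simp] lemma mul_a (x y : Heisenberg R) : (x * y).a = x.a + y.a := rfl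
@[simp] lemma mul_b (x y : Heisenberg R) : (x * y).b = x.b + y.b := rfl
@[simp] lemma mul_c (x y : Heisenberg R) : (x * y).c = x.c + y.c + x.b * y.a := rfl
@[simp] lemma one_a : (1 : Heisenberg R).a = 0 := rfl
@[simp] lemma one_b : (1 : Heisenberg R).b = 0 := rfl
@[simp] lemma one_c : (1 : Heisenberg R).c = 0 := rfl
@[simp] lemma inv_a (x : Heisenberg R) : x⁻¹.a = -x.a := rfl
@[simp] lemma inv_b (x : Heisenberg R) : x⁻¹.b = -x.b := rfl
@[simp] lemma inv_c (x : Heisenberg R) : x⁻¹.c = -x.c + x.b * x.a := rfl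

/-- Matrix multiplication of unitriangular matrices makes `H₃(R)` a group. -/
instance : Group (Heisenberg R) where
  mul := (· * ·)
  one := 1
  inv := (·⁻¹)
  mul_assoc x y z := by ext <;> simp only [mul_a, mul_b, mul_c] <;> ring
  one_mul x := by ext <;> simp only [mul_a, mul_b, mul_c, one_a, one_b, one_c] <;> ring
  mul_one x := by ext <;> simp only [mul_a, mul_b, mul_c, one_a, one_b, one_c] <;> ring
  inv_mul_cancel x := by
    ext <;> simp only [mul_a, mul_b, mul_c, inv_a, inv_b, inv_c, one_a, one_b, one_c] <;> ring

end Heisenberg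

namespace Stmt10

/-- Generators of the presented group `G*`. -/
inductive Gen
  | x1 | x2 | y1 | y2 | z1 | z2 | w1 | w2 | w3 | w4 | v1 | v2 | u1 | u2
  deriving DecidableEq

open Gen FreeGroup

/-- The commutator `[a,b] = a⁻¹b⁻¹ab`. -/
def comm (a b : FreeGroup Gen) : FreeGroup Gen := a⁻¹ * b⁻¹ * a * b

/-- The ordered pairs of generators whose commutator is specified by one of the listed
(possibly nontrivial) relations. -/
def specified : List (Gen × Gen) :=
  [(y1, x1), (y1, x2), (y2, x1), (y2, x2), (x2, x1), (y2, y1),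
   (z1, x1), (z1, x2), (z1, y1), (z1, y2), (z2, x1), (z2, y1), (z2, x2), (z2, y2)]

/-- The relators of `G*` (here `k ∈ 𝔽_p`, and `zᵏ` means `z` raised to the integer
representative `k.val`): the listed commutator relations, the `p`-th power relations, and
trivial commutator relations for every pair of generators whose commutator is not
determined by the listed relations (in particular `w₁, w₂, w₃, w₄, u₁, u₂, v₁, v₂` are
central and `[z₁,z₂] = 1`). -/
def rels (p : ℕ) (k : ZMod p) : Set (FreeGroup Gen) :=
  ({comm (of y1) (of x1) * (of z1)⁻¹,
    comm (of y1) (of x2) * (of z2)⁻¹,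
    comm (of y2) (of x1) * (of z2 * of w2)⁻¹,
    comm (of y2) (of x2) * (of z1 ^ k.val * of w3)⁻¹,
    comm (of x2) (of x1) * (of w1)⁻¹,
    comm (of y2) (of y1) * (of w4)⁻¹,
    comm (of z1) (of x1) * (of v1)⁻¹,
    comm (of z1) (of x2) * (of v2)⁻¹,
    comm (of z1) (of y1) * (of u1)⁻¹,
    comm (of z1) (of y2) * (of u2)⁻¹,
    comm (of z2) (of x1) * (of v2)⁻¹,
    comm (of z2) (of y1) * (of u2)⁻¹,
    comm (of z2) (of x2) * (of v1 ^ k.val)⁻¹,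
    comm (of z2) (of y2) * (of u1 ^ k.val)⁻¹} : Set (FreeGroup Gen)) ∪
  {r | ∃ g h : Gen, r = comm (of g) (of h) ∧ (g, h) ∉ specified ∧ (h, g) ∉ specified} ∪
  ({of x1 ^ p, of x2 ^ p, of y1 ^ p, of y2 ^ p, of z1 ^ p, of z2 ^ p,
    of w1 ^ p, of w2 ^ p, of w3 ^ p, of w4 ^ p} : Set (FreeGroup Gen))

/-- The group `G*` presented by the generators and relations above. -/
abbrev Gstar (p : ℕ) (k : ZMod p) := PresentedGroup (rels p k)

/-- The subgroup `A` of `G*` generated by the images of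
`w₁, w₂, w₃, w₄, u₁, u₂, v₁, v₂`. -/
def A (p : ℕ) (k : ZMod p) : Subgroup (Gstar p k) :=
  Subgroup.closure
    {PresentedGroup.of w1, PresentedGroup.of w2, PresentedGroup.of w3,
     PresentedGroup.of w4, PresentedGroup.of u1, PresentedGroup.of u2,
     PresentedGroup.of v1, PresentedGroup.of v2}

section Bound

variable {G : Type*} [Group G]

open scoped Pointwise in
/-- If an element `g` with `g ^ n = 1` normalizes a finite subgroup `H`, adjoining `g` to `H`
multiplies its order by at most `n`. -/
lemma finite_sup_zpowers_and_card_le {n : ℕ} (hn : n ≠ 0) {g : G} (hg : g ^ n = 1)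
    (H : Subgroup G) [Finite H] (h : ∀ s ∈ H, g⁻¹ * s * g ∈ H) :
    Finite (Subgroup.zpowers g ⊔ H : Subgroup G) ∧
      Nat.card (Subgroup.zpowers g ⊔ H : Subgroup G) ≤ n * Nat.card H := by
  have hnorm : Subgroup.zpowers g ≤ Subgroup.normalizer (H : Set G) := by
    rw [Subgroup.zpowers_le, ← inv_mem_iff]
    have : Finite (H : Set G) := ‹_›
    exact Subgroup.mem_normalizer_fintype fun s hs => by simpa using h s hs
  have hfin : IsOfFinOrder g := isOfFinOrder_iff_pow_eq_one.2 ⟨n, Nat.pos_of_ne_zero hn, hg⟩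
  have hcoe := Subgroup.coe_mul_of_left_le_normalizer_right _ H hnorm
  have hz : (Subgroup.zpowers g : Set G).Finite := hfin.finite_zpowers
  have hH : (H : Set G).Finite := Set.toFinite _
  refine ⟨((hz.mul hH).subset hcoe.le).to_subtype, ?_⟩
  calc Nat.card (Subgroup.zpowers g ⊔ H : Subgroup G)
      = Nat.card ((Subgroup.zpowers g : Set G) * (H : Set G) : Set G) := by
        rw [← hcoe]; rfl
    _ ≤ Nat.card (Subgroup.zpowers g : Set G) * Nat.card (H : Set G) := Set.natCard_mul_le
    _ ≤ n * Nat.card H := by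
        refine Nat.mul_le_mul_right _ ?_
        change Nat.card (Subgroup.zpowers g) ≤ n
        rw [Nat.card_zpowers]
        exact orderOf_le_of_pow_eq_one (Nat.pos_of_ne_zero hn) hg

/-- `IsPolycyclicList n l` says that every entry `g` of `l` satisfies `g ^ n = 1`, and that its
commutators with the later entries lie in the subgroup generated by the later entries. -/
def IsPolycyclicList (n : ℕ) : List G → Prop
  | [] => True
  | g :: l => g ^ n = 1 ∧ (∀ s ∈ l, s⁻¹ * g⁻¹ * s * g ∈ Subgroup.closure {x | x ∈ l}) ∧
      IsPolycyclicList n l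

lemma IsPolycyclicList.finite_and_card_le {n : ℕ} (hn : n ≠ 0) :
    ∀ {l : List G}, IsPolycyclicList n l →
      Finite (Subgroup.closure {x | x ∈ l}) ∧
        Nat.card (Subgroup.closure {x | x ∈ l}) ≤ n ^ l.length
  | [], _ => by
      simp only [List.not_mem_nil, Set.ofPred_false, Subgroup.closure_empty]
      exact ⟨inferInstance, by simp⟩
  | g :: l, ⟨hg, hc, hl⟩ => by
      obtain ⟨hfin, hcard⟩ := hl.finite_and_card_le hn
      have hconj : ∀ s ∈ Subgroup.closure {x | x ∈ l},
          g⁻¹ * s * g ∈ Subgroup.closure {x | x ∈ l} := by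
        intro s hs
        induction hs using Subgroup.closure_induction with
        | mem s hs =>
          have := mul_mem (Subgroup.subset_closure hs) (hc s hs)
          simpa [mul_assoc] using this
        | one => simp
        | mul a b _ _ ha hb => simpa [mul_assoc] using mul_mem ha hb
        | inv a _ ha => simpa [mul_assoc] using inv_mem ha
      have hcl : Subgroup.closure {x | x ∈ g :: l} =
          Subgroup.zpowers g ⊔ Subgroup.closure {x | x ∈ l} := by
        rw [Subgroup.zpowers_eq_closure, ← Subgroup.closure_union]
        congr 1
        ext x
        simp
      rw [hcl]
      obtain ⟨h₁, h₂⟩ := finite_sup_zpowers_and_card_le hn hg _ hconj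
      refine ⟨h₁, h₂.trans ?_⟩
      rw [List.length_cons, pow_succ']
      exact Nat.mul_le_mul_left _ hcard

end Bound

/-- A coordinate model of `G*` over a commutative ring `F`: the function `m` stands for the
normal form `x₁ ^ m x₁ * x₂ ^ m x₂ * y₁ ^ m y₁ * ⋯`. -/
def Model (F : Type*) [CommRing F] (_k : F) := Gen → F

namespace Model

variable {F : Type*} [CommRing F] {k : F}

@[ext] lemma ext {m n : Model F k} (h : ∀ i, m i = n i) : m = n := funext h

/-- The model of `gˢ` for a generator `g`. -/
def single (g : Gen) (s : F) : Model F k := fun i => if i = g then s else 0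

lemma single_apply (g : Gen) (s : F) (i : Gen) :
    (single g s : Model F k) i = if i = g then s else 0 := rfl

instance : One (Model F k) := ⟨fun _ => 0⟩

lemma one_apply (i : Gen) : (1 : Model F k) i = 0 := rfl

variable [Invertible (2 : F)]

/-- The polynomial `s (s - 1) / 2`. -/
def binom (s : F) : F := ⅟2 * (s * (s - 1))

@[simp] lemma binom_zero : binom (0 : F) = 0 := by simp [binom]

@[simp] lemma binom_one : binom (1 : F) = 0 := by simp [binom]

lemma binom_add (s t : F) : binom (s + t) = binom s + binom t + s * t := by
  unfold binom
  linear_combination (s * t) * invOf_mul_self (2 : F)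

instance : Mul (Model F k) :=
  ⟨fun m n i => match i with
    | x1 => m x1 + n x1
    | x2 => m x2 + n x2
    | y1 => m y1 + n y1
    | y2 => m y2 + n y2
    | z1 => m z1 + n z1 + (m y1 * n x1 + k * (m y2 * n x2))
    | z2 => m z2 + n z2 + (m y1 * n x2 + m y2 * n x1)
    | w1 => m w1 + n w1 + m x2 * n x1
    | w2 => m w2 + n w2 + m y2 * n x1
    | w3 => m w3 + n w3 + m y2 * n x2
    | w4 => m w4 + n w4 + m y2 * n y1
    | v1 => m v1 + n v1 + (m z1 * n x1 + k * (m z2 * n x2)) +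
        (m y1 * (binom (n x1) + k * binom (n x2)) + k * (m y2 * (n x1 * n x2)))
    | v2 => m v2 + n v2 + (m z1 * n x2 + m z2 * n x1) +
        (m y1 * (n x1 * n x2) + m y2 * (binom (n x1) + k * binom (n x2)))
    | u1 => m u1 + n u1 + ((m z1 + (m y1 * n x1 + k * (m y2 * n x2))) * n y1 +
          k * ((m z2 + (m y1 * n x2 + m y2 * n x1)) * n y2)) +
        (n x1 * (binom (m y1) + k * binom (m y2)) + k * (n x2 * (m y1 * m y2)))
    | u2 => m u2 + n u2 + ((m z1 + (m y1 * n x1 + k * (m y2 * n x2))) * n y2 +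
          (m z2 + (m y1 * n x2 + m y2 * n x1)) * n y1) +
        (n x1 * (m y1 * m y2) + n x2 * (binom (m y1) + k * binom (m y2)))⟩

instance : Inv (Model F k) :=
  ⟨fun m i => match i with
    | x1 => -m x1
    | x2 => -m x2
    | y1 => -m y1
    | y2 => -m y2
    | z1 => -m z1 + (m y1 * m x1 + k * (m y2 * m x2))
    | z2 => -m z2 + (m y1 * m x2 + m y2 * m x1)
    | w1 => -m w1 + m x2 * m x1
    | w2 => -m w2 + m y2 * m x1
    | w3 => -m w3 + m y2 * m x2
    | w4 => -m w4 + m y2 * m y1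
    | v1 => -m v1 + ((m z1 - (m y1 * m x1 + k * (m y2 * m x2))) * m x1 +
          k * ((m z2 - (m y1 * m x2 + m y2 * m x1)) * m x2)) +
        (m y1 * (binom (m x1) + k * binom (m x2)) + k * (m y2 * (m x1 * m x2)))
    | v2 => -m v2 + ((m z1 - (m y1 * m x1 + k * (m y2 * m x2))) * m x2 +
          (m z2 - (m y1 * m x2 + m y2 * m x1)) * m x1) +
        (m y1 * (m x1 * m x2) + m y2 * (binom (m x1) + k * binom (m x2)))
    | u1 => -m u1 + (m z1 * m y1 + k * (m z2 * m y2)) -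
        (m x1 * (binom (-m y1) + k * binom (-m y2)) + k * (m x2 * (m y1 * m y2)))
    | u2 => -m u2 + (m z1 * m y2 + m z2 * m y1) -
        (m x1 * (m y1 * m y2) + m x2 * (binom (-m y1) + k * binom (-m y2)))⟩

section Coordinates

variable (m n : Model F k)

lemma mul_x1 : (m * n) x1 = m x1 + n x1 := rfl
lemma mul_x2 : (m * n) x2 = m x2 + n x2 := rfl
lemma mul_y1 : (m * n) y1 = m y1 + n y1 := rfl
lemma mul_y2 : (m * n) y2 = m y2 + n y2 := rfl
lemma mul_z1 : (m * n) z1 = m z1 + n z1 + (m y1 * n x1 + k * (m y2 * n x2)) := rfl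
lemma mul_z2 : (m * n) z2 = m z2 + n z2 + (m y1 * n x2 + m y2 * n x1) := rfl
lemma mul_w1 : (m * n) w1 = m w1 + n w1 + m x2 * n x1 := rfl
lemma mul_w2 : (m * n) w2 = m w2 + n w2 + m y2 * n x1 := rfl
lemma mul_w3 : (m * n) w3 = m w3 + n w3 + m y2 * n x2 := rfl
lemma mul_w4 : (m * n) w4 = m w4 + n w4 + m y2 * n y1 := rfl
lemma mul_v1 : (m * n) v1 = m v1 + n v1 + (m z1 * n x1 + k * (m z2 * n x2)) +
    (m y1 * (binom (n x1) + k * binom (n x2)) + k * (m y2 * (n x1 * n x2))) := rfl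
lemma mul_v2 : (m * n) v2 = m v2 + n v2 + (m z1 * n x2 + m z2 * n x1) +
    (m y1 * (n x1 * n x2) + m y2 * (binom (n x1) + k * binom (n x2))) := rfl
lemma mul_u1 : (m * n) u1 = m u1 + n u1 + ((m z1 + (m y1 * n x1 + k * (m y2 * n x2))) * n y1 +
      k * ((m z2 + (m y1 * n x2 + m y2 * n x1)) * n y2)) +
    (n x1 * (binom (m y1) + k * binom (m y2)) + k * (n x2 * (m y1 * m y2))) := rfl
lemma mul_u2 : (m * n) u2 = m u2 + n u2 + ((m z1 + (m y1 * n x1 + k * (m y2 * n x2))) * n y2 +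
      (m z2 + (m y1 * n x2 + m y2 * n x1)) * n y1) +
    (n x1 * (m y1 * m y2) + n x2 * (binom (m y1) + k * binom (m y2))) := rfl

end Coordinates

instance : Group (Model F k) where
  mul_assoc l m n := by
    ext i
    cases i <;>
      simp only [mul_x1, mul_x2, mul_y1, mul_y2, mul_z1, mul_z2, mul_w1, mul_w2, mul_w3, mul_w4,
        mul_v1, mul_v2, mul_u1, mul_u2, binom_add] <;> ring
  one_mul m := by
    ext i
    cases i <;>
      simp [mul_x1, mul_x2, mul_y1, mul_y2, mul_z1, mul_z2, mul_w1, mul_w2, mul_w3, mul_w4,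
        mul_v1, mul_v2, mul_u1, mul_u2, one_apply]
  mul_one m := by
    ext i
    cases i <;>
      simp [mul_x1, mul_x2, mul_y1, mul_y2, mul_z1, mul_z2, mul_w1, mul_w2, mul_w3, mul_w4,
        mul_v1, mul_v2, mul_u1, mul_u2, one_apply]
  inv_mul_cancel m := by
    ext i
    cases i <;>
      simp only [mul_x1, mul_x2, mul_y1, mul_y2, mul_z1, mul_z2, mul_w1, mul_w2, mul_w3, mul_w4,
        mul_v1, mul_v2, mul_u1, mul_u2, one_apply] <;> dsimp only [Inv.inv] <;> ring

lemma single_mul_single (g : Gen) (s t : F) :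
    (single g s * single g t : Model F k) = single g (s + t) := by
  ext i
  cases g <;> cases i <;>
    simp [mul_x1, mul_x2, mul_y1, mul_y2, mul_z1, mul_z2, mul_w1, mul_w2, mul_w3, mul_w4,
      mul_v1, mul_v2, mul_u1, mul_u2, single_apply]

lemma single_one_pow (g : Gen) (n : ℕ) : (single g 1 : Model F k) ^ n = single g (n : F) := by
  induction n with
  | zero =>
    ext i
    simp [one_apply, single_apply]
  | succ n ih => rw [pow_succ, ih, single_mul_single, Nat.cast_succ]

/-- The element with the given `w₁, w₂, w₃, w₄, u₁, u₂, v₁, v₂` coordinates and all other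
coordinates zero. -/
def ofCentral (c : Fin 8 → F) : Model F k
  | w1 => c 0
  | w2 => c 1
  | w3 => c 2
  | w4 => c 3
  | u1 => c 4
  | u2 => c 5
  | v1 => c 6
  | v2 => c 7
  | _ => 0

/-- The embedding of the elements supported on the coordinates `w₁, w₂, w₃, w₄, u₁, u₂, v₁, v₂`. -/
def central : Multiplicative (Fin 8 → F) →* Model F k where
  toFun c := ofCentral c.toAdd
  map_one' := by ext i; cases i <;> simp [one_apply, ofCentral]
  map_mul' c d := by
    ext i
    cases i <;>
      simp [mul_x1, mul_x2, mul_y1, mul_y2, mul_z1, mul_z2, mul_w1, mul_w2, mul_w3, mul_w4,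
        mul_v1, mul_v2, mul_u1, mul_u2, ofCentral]

lemma central_apply (c : Multiplicative (Fin 8 → F)) :
    (central c : Model F k) = ofCentral c.toAdd := rfl

lemma central_injective : Function.Injective (central : _ →* Model F k) := by
  intro c d h
  have h' (i : Gen) : (central c : Model F k) i = (central d : Model F k) i := by rw [h]
  apply Multiplicative.toAdd.injective
  funext j
  fin_cases j
  exacts [h' w1, h' w2, h' w3, h' w4, h' u1, h' u2, h' v1, h' v2]

lemma central_eq_prod (c : Fin 8 → F) : (central (.ofAdd c) : Model F k) =
    single w1 (c 0) * single w2 (c 1) * single w3 (c 2) * single w4 (c 3) *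
      single u1 (c 4) * single u2 (c 5) * single v1 (c 6) * single v2 (c 7) := by
  ext i
  cases i <;>
    simp [mul_x1, mul_x2, mul_y1, mul_y2, mul_z1, mul_z2, mul_w1, mul_w2, mul_w3, mul_w4,
      mul_v1, mul_v2, mul_u1, mul_u2, single_apply, central_apply, ofCentral]

lemma mem_range_central {m : Model F k} (h1 : m x1 = 0) (h2 : m x2 = 0) (h3 : m y1 = 0)
    (h4 : m y2 = 0) (h5 : m z1 = 0) (h6 : m z2 = 0) : m ∈ (central : _ →* Model F k).range := by
  refine ⟨.ofAdd ![m w1, m w2, m w3, m w4, m u1, m u2, m v1, m v2], ?_⟩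
  ext i
  cases i <;> simp [central_apply, ofCentral, *]

/-- Every element is a product of powers of the generators, in the order of the normal form. -/
lemma eq_prod_single (m : Model F k) : m =
    single x1 (m x1) * single x2 (m x2) * single y1 (m y1) * single y2 (m y2) *
      single z1 (m z1) * single z2 (m z2) *
      central (.ofAdd ![m w1, m w2, m w3, m w4, m u1, m u2, m v1, m v2]) := by
  ext i
  cases i <;>
    simp [mul_x1, mul_x2, mul_y1, mul_y2, mul_z1, mul_z2, mul_w1, mul_w2, mul_w3, mul_w4,
      mul_v1, mul_v2, mul_u1, mul_u2, single_apply, central_apply, ofCentral]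

/-- The projection of the model onto the Heisenberg group of a ring containing a square root
of `k`. -/
def toHeisenberg {R : Type*} [CommRing R] [Algebra F R] (t : R) (ht : t ^ 2 = algebraMap F R k) :
    Model F k →* Heisenberg R where
  toFun m := ⟨algebraMap F R (m x1) + algebraMap F R (m x2) * t,
    algebraMap F R (m y1) + algebraMap F R (m y2) * t,
    algebraMap F R (m z1) + algebraMap F R (m z2) * t⟩
  map_one' := by ext <;> simp [one_apply]
  map_mul' m n := by
    ext <;> simp only [mul_x1, mul_x2, mul_y1, mul_y2, mul_z1, mul_z2, map_add, _root_.map_mul,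
      Heisenberg.mul_a, Heisenberg.mul_b, Heisenberg.mul_c, ← ht] <;> ring

end Model

namespace Gstar

variable {p : ℕ} {k : ZMod p}

/-- The image in `G*` of a generator. -/
abbrev gen (g : Gen) : Gstar p k := PresentedGroup.of g

lemma comm_eq_of_mem {g h : Gen} {r : FreeGroup Gen}
    (hr : comm (of g) (of h) * r⁻¹ ∈ rels p k) :
    (gen g)⁻¹ * (gen h)⁻¹ * gen g * gen h = PresentedGroup.mk (rels p k) r := by
  rw [← PresentedGroup.mk_eq_mk_of_mul_inv_mem hr]
  simp [comm, gen, PresentedGroup.of]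

lemma comm_y1_x1 : (gen y1)⁻¹ * (gen x1)⁻¹ * gen y1 * gen x1 = (gen z1 : Gstar p k) :=
  comm_eq_of_mem (by simp [rels])

lemma comm_y1_x2 : (gen y1)⁻¹ * (gen x2)⁻¹ * gen y1 * gen x2 = (gen z2 : Gstar p k) :=
  comm_eq_of_mem (by simp [rels])

lemma comm_y2_x1 :
    (gen y2)⁻¹ * (gen x1)⁻¹ * gen y2 * gen x1 = (gen z2 * gen w2 : Gstar p k) :=
  comm_eq_of_mem (r := of z2 * of w2) (Or.inl (Or.inl (by
    simp only [Set.mem_insert_iff, true_or, or_true])))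

lemma comm_y2_x2 :
    (gen y2)⁻¹ * (gen x2)⁻¹ * gen y2 * gen x2 = (gen z1 ^ k.val * gen w3 : Gstar p k) :=
  comm_eq_of_mem (r := of z1 ^ k.val * of w3) (Or.inl (Or.inl (by
    simp only [Set.mem_insert_iff, true_or, or_true])))

lemma comm_x2_x1 : (gen x2)⁻¹ * (gen x1)⁻¹ * gen x2 * gen x1 = (gen w1 : Gstar p k) :=
  comm_eq_of_mem (by simp [rels])

lemma comm_y2_y1 : (gen y2)⁻¹ * (gen y1)⁻¹ * gen y2 * gen y1 = (gen w4 : Gstar p k) :=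
  comm_eq_of_mem (by simp [rels])

lemma comm_z1_x1 : (gen z1)⁻¹ * (gen x1)⁻¹ * gen z1 * gen x1 = (gen v1 : Gstar p k) :=
  comm_eq_of_mem (by simp [rels])

lemma comm_z1_x2 : (gen z1)⁻¹ * (gen x2)⁻¹ * gen z1 * gen x2 = (gen v2 : Gstar p k) :=
  comm_eq_of_mem (by simp [rels])

lemma comm_z1_y1 : (gen z1)⁻¹ * (gen y1)⁻¹ * gen z1 * gen y1 = (gen u1 : Gstar p k) :=
  comm_eq_of_mem (by simp [rels])

lemma comm_z1_y2 : (gen z1)⁻¹ * (gen y2)⁻¹ * gen z1 * gen y2 = (gen u2 : Gstar p k) :=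
  comm_eq_of_mem (by simp [rels])

lemma comm_z2_x1 : (gen z2)⁻¹ * (gen x1)⁻¹ * gen z2 * gen x1 = (gen v2 : Gstar p k) :=
  comm_eq_of_mem (by simp [rels])

lemma comm_z2_y1 : (gen z2)⁻¹ * (gen y1)⁻¹ * gen z2 * gen y1 = (gen u2 : Gstar p k) :=
  comm_eq_of_mem (by simp [rels])

lemma comm_z2_x2 :
    (gen z2)⁻¹ * (gen x2)⁻¹ * gen z2 * gen x2 = (gen v1 ^ k.val : Gstar p k) :=
  comm_eq_of_mem (r := of v1 ^ k.val) (Or.inl (Or.inl (by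
    simp only [Set.mem_insert_iff, true_or, or_true])))

lemma comm_z2_y2 :
    (gen z2)⁻¹ * (gen y2)⁻¹ * gen z2 * gen y2 = (gen u1 ^ k.val : Gstar p k) :=
  comm_eq_of_mem (r := of u1 ^ k.val) (Or.inl (Or.inl (by
    simp only [Set.mem_insert_iff, Set.mem_singleton_iff, or_true])))

lemma comm_eq_one {g h : Gen} (h₁ : (g, h) ∉ specified) (h₂ : (h, g) ∉ specified) :
    (gen g)⁻¹ * (gen h)⁻¹ * gen g * gen h = (1 : Gstar p k) := by
  have hr : comm (of g) (of h) ∈ rels p k := Or.inl (Or.inr ⟨g, h, rfl, h₁, h₂⟩)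
  simpa [comm, gen, PresentedGroup.of] using PresentedGroup.one_of_mem hr

lemma commute_gen {g h : Gen} (h₁ : (g, h) ∉ specified) (h₂ : (h, g) ∉ specified) :
    Commute (gen g : Gstar p k) (gen h) := by
  have := comm_eq_one (p := p) (k := k) h₂ h₁
  rw [mul_assoc, ← mul_inv_rev, inv_mul_eq_one] at this
  exact this

/-- A generator occurring in none of the listed commutators is central. -/
lemma gen_mem_center {g : Gen} (hg : ∀ h, (g, h) ∉ specified ∧ (h, g) ∉ specified) :
    (gen g : Gstar p k) ∈ Subgroup.center (Gstar p k) := by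
  rw [Subgroup.mem_center_iff]
  intro x
  have hx : x ∈ Subgroup.centralizer {(gen g : Gstar p k)} :=
    PresentedGroup.generated_by _ _ (fun h => by
      rw [Subgroup.mem_centralizer_singleton_iff]
      exact (commute_gen (hg h).2 (hg h).1)) x
  exact Subgroup.mem_centralizer_singleton_iff.1 hx

lemma pow_eq_one_of_comm {G : Type*} [Group G] {n : ℕ} {a b c : G} (ha : a ^ n = 1)
    (hc : c ∈ Subgroup.center G) (h : a⁻¹ * b⁻¹ * a * b = c) : c ^ n = 1 := by
  have hconj : b⁻¹ * a * b⁻¹⁻¹ = a * c := by rw [← h]; group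
  have hcomm : Commute a c := Subgroup.mem_center_iff.1 hc a
  have := congrArg (· ^ n) hconj
  simpa only [conj_pow, hcomm.mul_pow, ha, one_mul, mul_one, mul_inv_cancel, eq_comm] using this

lemma gen_pow (g : Gen) : (gen g : Gstar p k) ^ p = 1 := by
  have key {g : Gen} (hg : of g ^ p ∈ rels p k) : (gen g : Gstar p k) ^ p = 1 := by
    simpa [gen, PresentedGroup.of] using PresentedGroup.one_of_mem hg
  have hz : (gen z1 : Gstar p k) ^ p = 1 := key (Or.inr (by
    simp only [Set.mem_insert_iff, true_or, or_true]))
  cases g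
  case v1 =>
    exact pow_eq_one_of_comm hz (gen_mem_center fun h => by cases h <;> decide) comm_z1_x1
  case v2 =>
    exact pow_eq_one_of_comm hz (gen_mem_center fun h => by cases h <;> decide) comm_z1_x2
  case u1 =>
    exact pow_eq_one_of_comm hz (gen_mem_center fun h => by cases h <;> decide) comm_z1_y1
  case u2 =>
    exact pow_eq_one_of_comm hz (gen_mem_center fun h => by cases h <;> decide) comm_z1_y2
  all_goals exact key (Or.inr (by
    simp only [Set.mem_insert_iff, Set.mem_singleton_iff, true_or, or_true]))

lemma isPolycyclicList_gens : IsPolycyclicList p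
    ([x1, x2, y1, y2, z1, z2, w1, w2, w3, w4, v1, v2, u1, u2].map
      (gen : Gen → Gstar p k)) := by
  have one {g h : Gen} {H : Subgroup (Gstar p k)} (h₁ : (g, h) ∉ specified)
      (h₂ : (h, g) ∉ specified) : (gen g)⁻¹ * (gen h)⁻¹ * gen g * gen h ∈ H := by
    rw [comm_eq_one h₁ h₂]
    exact one_mem H
  have sub {l : List (Gstar p k)} {a : Gstar p k} (ha : a ∈ l) :
      a ∈ Subgroup.closure {x | x ∈ l} := Subgroup.subset_closure ha
  simp only [List.map_cons, List.map_nil, IsPolycyclicList, gen_pow, true_and, and_true,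
    List.forall_mem_cons, List.not_mem_nil, false_imp_iff, implies_true]
  repeat' apply And.intro
  all_goals try exact one (by decide) (by decide)
  · exact comm_x2_x1 ▸ sub (by simp)
  · exact comm_y1_x1 ▸ sub (by simp)
  · exact comm_y2_x1 ▸ mul_mem (sub (by simp)) (sub (by simp))
  · exact comm_z1_x1 ▸ sub (by simp)
  · exact comm_z2_x1 ▸ sub (by simp)
  · exact comm_y1_x2 ▸ sub (by simp)
  · exact comm_y2_x2 ▸ mul_mem (pow_mem (sub (by simp)) _) (sub (by simp))
  · exact comm_z1_x2 ▸ sub (by simp)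
  · exact comm_z2_x2 ▸ pow_mem (sub (by simp)) _
  · exact comm_y2_y1 ▸ sub (by simp)
  · exact comm_z1_y1 ▸ sub (by simp)
  · exact comm_z2_y1 ▸ sub (by simp)
  · exact comm_z1_y2 ▸ sub (by simp)
  · exact comm_z2_y2 ▸ pow_mem (sub (by simp)) _

lemma finite_and_card_le [NeZero p] : Finite (Gstar p k) ∧ Nat.card (Gstar p k) ≤ p ^ 14 := by
  obtain ⟨hfin, hcard⟩ :=
    (isPolycyclicList_gens (p := p) (k := k)).finite_and_card_le (NeZero.ne p)
  have htop : Subgroup.closure {x | x ∈ [x1, x2, y1, y2, z1, z2, w1, w2, w3, w4, v1, v2, u1,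
      u2].map (gen : Gen → Gstar p k)} = ⊤ := by
    rw [eq_top_iff]
    intro x _
    refine PresentedGroup.generated_by _ _ (fun g => Subgroup.subset_closure ?_) x
    cases g <;> simp
  rw [htop] at hfin hcard
  exact ⟨Finite.of_equiv _ Subgroup.topEquiv.toEquiv,
    (Nat.card_congr Subgroup.topEquiv.toEquiv).symm.le.trans hcard⟩

lemma gen_mem_A {g : Gen} (hg : g ∈ [w1, w2, w3, w4, u1, u2, v1, v2]) :
    (gen g : Gstar p k) ∈ A p k := by
  refine Subgroup.subset_closure ?_
  simp only [List.mem_cons, List.not_mem_nil, or_false] at hg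
  rcases hg with rfl | rfl | rfl | rfl | rfl | rfl | rfl | rfl <;> simp

/-- A subgroup of `G*` contains `A` as soon as it contains its eight generators. -/
lemma A_le {H : Subgroup (Gstar p k)}
    (h : ∀ g ∈ [w1, w2, w3, w4, u1, u2, v1, v2], (gen g : Gstar p k) ∈ H) : A p k ≤ H := by
  rw [A, Subgroup.closure_le]
  rintro x (rfl | rfl | rfl | rfl | rfl | rfl | rfl | rfl) <;> exact h _ (by simp)

lemma A_le_center : A p k ≤ Subgroup.center (Gstar p k) := by
  refine A_le fun g hg => gen_mem_center fun h => ?_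
  simp only [List.mem_cons, List.not_mem_nil, or_false] at hg
  rcases hg with rfl | rfl | rfl | rfl | rfl | rfl | rfl | rfl <;> cases h <;> decide

lemma A_le_commutator : A p k ≤ commutator (Gstar p k) := by
  have hc (a b : Gstar p k) : a⁻¹ * b⁻¹ * a * b ∈ commutator (Gstar p k) := by
    have := Subgroup.commutator_mem_commutator (Subgroup.mem_top a⁻¹) (Subgroup.mem_top b⁻¹)
    simpa [commutator_def, commutatorElement_def] using this
  refine A_le fun g hg => ?_
  simp only [List.mem_cons, List.not_mem_nil, or_false] at hg
  rcases hg with rfl | rfl | rfl | rfl | rfl | rfl | rfl | rfl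
  · exact comm_x2_x1 (k := k) ▸ hc _ _
  · have hz : (gen z2 : Gstar p k) ∈ commutator _ := comm_y1_x2 (k := k) ▸ hc _ _
    exact (Subgroup.mul_mem_cancel_left _ hz).1 (comm_y2_x1 (k := k) ▸ hc _ _)
  · have hz : (gen z1 : Gstar p k) ∈ commutator _ := comm_y1_x1 (k := k) ▸ hc _ _
    exact (Subgroup.mul_mem_cancel_left _ (pow_mem hz _)).1 (comm_y2_x2 (k := k) ▸ hc _ _)
  · exact comm_y2_y1 (k := k) ▸ hc _ _
  · exact comm_z1_y1 (k := k) ▸ hc _ _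
  · exact comm_z1_y2 (k := k) ▸ hc _ _
  · exact comm_z1_x1 (k := k) ▸ hc _ _
  · exact comm_z1_x2 (k := k) ▸ hc _ _

lemma card_model [NeZero p] : Nat.card (Model (ZMod p) k) = p ^ 14 := by
  have e : Gen ≃ Fin 14 :=
    { toFun := fun
        | x1 => 0 | x2 => 1 | y1 => 2 | y2 => 3 | z1 => 4 | z2 => 5 | w1 => 6 | w2 => 7
        | w3 => 8 | w4 => 9 | v1 => 10 | v2 => 11 | u1 => 12 | u2 => 13
      invFun := ![x1, x2, y1, y2, z1, z2, w1, w2, w3, w4, v1, v2, u1, u2]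
      left_inv := fun g => by cases g <;> rfl
      right_inv := fun i => by fin_cases i <;> rfl }
  change Nat.card (Gen → ZMod p) = p ^ 14
  rw [Nat.card_congr (e.arrowCongr (Equiv.refl (ZMod p))), Nat.card_fun, Nat.card_zmod,
    Nat.card_fin]

variable [Invertible (2 : ZMod p)]

set_option maxHeartbeats 1000000 in
lemma commute_single {g h : Gen} (h₁ : (g, h) ∉ specified) (h₂ : (h, g) ∉ specified) :
    (Model.single g 1 * Model.single h 1 : Model (ZMod p) k) =
      Model.single h 1 * Model.single g 1 := by
  cases g <;> cases h <;> first
    | rfl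
    | exact absurd (by decide) h₁
    | exact absurd (by decide) h₂
    | (ext i
       cases i <;>
        simp [Model.mul_x1, Model.mul_x2, Model.mul_y1, Model.mul_y2, Model.mul_z1, Model.mul_z2,
          Model.mul_w1, Model.mul_w2, Model.mul_w3, Model.mul_w4, Model.mul_v1, Model.mul_v2,
          Model.mul_u1, Model.mul_u2, Model.single_apply])

set_option maxHeartbeats 1000000 in
/-- The generators of the model satisfy the defining relations of `G*`. -/
lemma lift_single_eq_one [NeZero p] : ∀ r ∈ rels p k,
    FreeGroup.lift (fun g => (Model.single g 1 : Model (ZMod p) k)) r = 1 := by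
  have key (a b r : Model (ZMod p) k) :
      a⁻¹ * b⁻¹ * a * b * r⁻¹ = 1 ↔ a * b = b * a * r := by
    rw [mul_inv_eq_one, mul_assoc, ← mul_inv_rev, inv_mul_eq_iff_eq_mul]
  have key' (a b : Model (ZMod p) k) : a⁻¹ * b⁻¹ * a * b = 1 ↔ a * b = b * a := by
    rw [mul_assoc, ← mul_inv_rev, inv_mul_eq_one, eq_comm]
  rintro r ((hr | ⟨g, h, rfl, h₁, h₂⟩) | hr)
  · simp only [Set.mem_insert_iff, Set.mem_singleton_iff] at hr
    rcases hr with rfl | rfl | rfl | rfl | rfl | rfl | rfl | rfl | rfl | rfl | rfl | rfl | rfl | rfl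
    all_goals
      simp only [comm, _root_.map_mul, _root_.map_inv, map_pow, lift_apply_of, key,
        Model.single_one_pow, ZMod.natCast_zmod_val]
      ext i
      cases i <;>
        simp [Model.mul_x1, Model.mul_x2, Model.mul_y1, Model.mul_y2, Model.mul_z1, Model.mul_z2,
          Model.mul_w1, Model.mul_w2, Model.mul_w3, Model.mul_w4, Model.mul_v1, Model.mul_v2,
          Model.mul_u1, Model.mul_u2, Model.single_apply]
  · simp only [comm, _root_.map_mul, _root_.map_inv, lift_apply_of, key']
    exact commute_single h₁ h₂
  · simp only [Set.mem_insert_iff, Set.mem_singleton_iff] at hr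
    rcases hr with rfl | rfl | rfl | rfl | rfl | rfl | rfl | rfl | rfl | rfl
    all_goals
      rw [map_pow, lift_apply_of, Model.single_one_pow, CharP.cast_eq_zero]
      ext i
      simp [Model.single_apply, Model.one_apply]

/-- The homomorphism from `G*` to its coordinate model. -/
def toModel [NeZero p] : Gstar p k →* Model (ZMod p) k :=
  PresentedGroup.toGroup lift_single_eq_one

@[simp] lemma toModel_gen [NeZero p] (g : Gen) :
    toModel (gen g : Gstar p k) = Model.single g 1 :=
  PresentedGroup.toGroup.of _

lemma toModel_gen_pow_val [NeZero p] (g : Gen) (s : ZMod p) :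
    toModel ((gen g : Gstar p k) ^ s.val) = Model.single g s := by
  rw [map_pow, toModel_gen, Model.single_one_pow, ZMod.natCast_zmod_val]

lemma map_toModel_A [NeZero p] :
    (A p k).map toModel = (Model.central : _ →* Model (ZMod p) k).range := by
  apply le_antisymm
  · rw [Subgroup.map_le_iff_le_comap]
    refine A_le fun g hg => ?_
    rw [Subgroup.mem_comap, toModel_gen]
    simp only [List.mem_cons, List.not_mem_nil, or_false] at hg
    rcases hg with rfl | rfl | rfl | rfl | rfl | rfl | rfl | rfl <;>
      apply Model.mem_range_central <;> simp [Model.single_apply]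
  · rintro _ ⟨c, rfl⟩
    have hs {g : Gen} (hg : g ∈ [w1, w2, w3, w4, u1, u2, v1, v2]) (s : ZMod p) :
        (Model.single g s : Model (ZMod p) k) ∈ (A p k).map toModel :=
      ⟨gen g ^ s.val, pow_mem (gen_mem_A hg) _, toModel_gen_pow_val g s⟩
    rw [← ofAdd_toAdd c, Model.central_eq_prod]
    refine mul_mem (mul_mem (mul_mem (mul_mem (mul_mem (mul_mem (mul_mem ?_ ?_) ?_) ?_) ?_) ?_)
      ?_) ?_ <;> exact hs (by simp) _

lemma toModel_surjective [NeZero p] :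
    Function.Surjective (toModel : Gstar p k →* Model (ZMod p) k) := by
  rw [← MonoidHom.range_eq_top, eq_top_iff]
  intro m _
  have hs (g : Gen) (s : ZMod p) :
      (Model.single g s : Model (ZMod p) k) ∈ (toModel : Gstar p k →* _).range :=
    ⟨gen g ^ s.val, toModel_gen_pow_val g s⟩
  have hc (c) : (Model.central c : Model (ZMod p) k) ∈ (toModel : Gstar p k →* _).range := by
    obtain ⟨x, -, hx⟩ : Model.central c ∈ (A p k).map toModel := by
      rw [map_toModel_A]
      exact ⟨c, rfl⟩
    exact ⟨x, hx⟩
  rw [Model.eq_prod_single m]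
  exact mul_mem (mul_mem (mul_mem (mul_mem (mul_mem (mul_mem (hs _ _) (hs _ _)) (hs _ _))
    (hs _ _)) (hs _ _)) (hs _ _)) (hc _)

lemma toModel_bijective [NeZero p] :
    Function.Bijective (toModel : Gstar p k →* Model (ZMod p) k) := by
  obtain ⟨hfin, hcard⟩ := finite_and_card_le (p := p) (k := k)
  refine toModel_surjective.bijective_of_nat_card_le ?_
  rwa [card_model]

end Gstar

section QuadraticQuotient

variable {F : Type*} [Field F] (k : F)

lemma algebraMap_add_mul_mk_X (a b : F) :
    algebraMap F (F[X] ⧸ Ideal.span {(X : F[X]) ^ 2 - C k}) a +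
        algebraMap F _ b * Ideal.Quotient.mk _ X =
      Ideal.Quotient.mk (Ideal.span {(X : F[X]) ^ 2 - C k}) (C b * X + C a) := by
  rw [add_comm, _root_.map_add, _root_.map_mul]
  rfl

lemma exists_eq_add_mul_mk_X (r : F[X] ⧸ Ideal.span {(X : F[X]) ^ 2 - C k}) :
    ∃ a b : F, algebraMap F _ a + algebraMap F _ b * Ideal.Quotient.mk _ X = r := by
  obtain ⟨q, rfl⟩ := Ideal.Quotient.mk_surjective r
  have hm : (X ^ 2 - C k : F[X]).Monic := monic_X_pow_sub_C k two_ne_zero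
  have hd : (q %ₘ (X ^ 2 - C k)).natDegree ≤ 1 := by
    have := natDegree_modByMonic_lt q hm (by
      intro h
      simpa [h] using natDegree_X_pow_sub_C (n := 2) (r := k))
    rw [natDegree_X_pow_sub_C] at this
    exact Nat.le_of_lt_succ this
  obtain ⟨b, a, hab⟩ := exists_eq_X_add_C_of_natDegree_le_one hd
  refine ⟨a, b, ?_⟩
  rw [algebraMap_add_mul_mk_X, ← hab, Ideal.Quotient.eq, Ideal.mem_span_singleton]
  refine ⟨-(q /ₘ (X ^ 2 - C k)), ?_⟩
  linear_combination modByMonic_add_div q (X ^ 2 - C k)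

lemma eq_zero_of_add_mul_mk_X_eq_zero {a b : F}
    (h : algebraMap F (F[X] ⧸ Ideal.span {(X : F[X]) ^ 2 - C k}) a +
      algebraMap F _ b * Ideal.Quotient.mk _ X = 0) : a = 0 ∧ b = 0 := by
  rw [algebraMap_add_mul_mk_X, Ideal.Quotient.eq_zero_iff_mem, Ideal.mem_span_singleton] at h
  have h0 : C b * X + C a = 0 := by
    refine eq_zero_of_dvd_of_natDegree_lt h ?_
    rw [natDegree_X_pow_sub_C]
    exact natDegree_linear_le.trans_lt one_lt_two
  exact ⟨by simpa using congrArg (coeff · 0) h0, by simpa using congrArg (coeff · 1) h0⟩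

end QuadraticQuotient

/-- For an odd prime `p` and a non-square `k ∈ 𝔽_pˣ` (so that `𝔽_p[t]/(t²-k) ≅ 𝔽_{p²}`),
the presented group `G*` has order `p¹⁴`, the subgroup `A` generated by
`w₁, w₂, w₃, w₄, u₁, u₂, v₁, v₂` is contained in `Z(G*) ∩ [G*,G*]`, is isomorphic to
`(ℤ/pℤ)⁸`, and `G*/A ≅ H₃(𝔽_p[t]/(t²-k))` (expressed via a surjective homomorphism with
kernel `A`).  Hence `G*` is a representation group of `H₃(𝔽_{p²})`. -/
theorem Gstar_is_representation_group (p : ℕ) [Fact p.Prime] (hodd : Odd p)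
    (k : ZMod p) (hk : ¬IsSquare k) :
    Nat.card (Gstar p k) = p ^ 14 ∧
    A p k ≤ Subgroup.center (Gstar p k) ⊓ commutator (Gstar p k) ∧
    Nonempty (A p k ≃* Multiplicative (Fin 8 → ZMod p)) ∧
    ∃ φ : Gstar p k →*
        Heisenberg ((ZMod p)[X] ⧸ Ideal.span {(X : (ZMod p)[X]) ^ 2 - C k}),
      Function.Surjective φ ∧ φ.ker = A p k := by
  have h2 : (2 : ZMod p) ≠ 0 := by
    intro h
    have hdvd : p ∣ 2 := (ZMod.natCast_eq_zero_iff 2 p).1 (by exact_mod_cast h)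
    rcases (Nat.dvd_prime Nat.prime_two).1 hdvd with h1 | h1
    · exact (Fact.out : p.Prime).one_lt.ne' h1
    · exact absurd hodd (by rw [h1]; decide)
  let _ : Invertible (2 : ZMod p) := invertibleOfNonzero h2
  have hbij := Gstar.toModel_bijective (p := p) (k := k)
  refine ⟨(Nat.card_congr (Equiv.ofBijective _ hbij)).trans Gstar.card_model,
    le_inf Gstar.A_le_center Gstar.A_le_commutator, ⟨?_⟩, ?_⟩
  · exact ((A p k).equivMapOfInjective _ hbij.injective).trans
      ((MulEquiv.subgroupCongr Gstar.map_toModel_A).trans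
        (MonoidHom.ofInjective Model.central_injective).symm)
  · let R := (ZMod p)[X] ⧸ Ideal.span {(X : (ZMod p)[X]) ^ 2 - C k}
    let t : R := Ideal.Quotient.mk _ X
    have ht : t ^ 2 = algebraMap (ZMod p) R k := by
      refine (Ideal.Quotient.eq (x := X ^ 2) (y := C k)).2 ?_
      exact Ideal.mem_span_singleton_self _
    let ψ : Model (ZMod p) k →* Heisenberg R := Model.toHeisenberg t ht
    refine ⟨ψ.comp Gstar.toModel, ?_, ?_⟩
    · rw [MonoidHom.coe_comp]
      refine Function.Surjective.comp ?_ hbij.surjective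
      rintro ⟨a, b, c⟩
      obtain ⟨a₁, a₂, rfl⟩ := exists_eq_add_mul_mk_X k a
      obtain ⟨b₁, b₂, rfl⟩ := exists_eq_add_mul_mk_X k b
      obtain ⟨c₁, c₂, rfl⟩ := exists_eq_add_mul_mk_X k c
      let m : Model (ZMod p) k := fun
        | x1 => a₁ | x2 => a₂ | y1 => b₁ | y2 => b₂ | z1 => c₁ | z2 => c₂ | _ => 0
      exact ⟨m, rfl⟩
    · apply le_antisymm
      · intro x hx
        have hψ : ψ (Gstar.toModel x) = 1 := hx
        obtain ⟨h₁, h₂⟩ := eq_zero_of_add_mul_mk_X_eq_zero k (congrArg Heisenberg.a hψ)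
        obtain ⟨h₃, h₄⟩ := eq_zero_of_add_mul_mk_X_eq_zero k (congrArg Heisenberg.b hψ)
        obtain ⟨h₅, h₆⟩ := eq_zero_of_add_mul_mk_X_eq_zero k (congrArg Heisenberg.c hψ)
        have hmem := Model.mem_range_central h₁ h₂ h₃ h₄ h₅ h₆
        rw [← Gstar.map_toModel_A] at hmem
        exact (Subgroup.mem_map_iff_mem hbij.injective).1 hmem
      · refine Gstar.A_le fun g hg => ?_
        rw [MonoidHom.mem_ker, MonoidHom.comp_apply, Gstar.toModel_gen]
        simp only [List.mem_cons, List.not_mem_nil, or_false] at hg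
        rcases hg with rfl | rfl | rfl | rfl | rfl | rfl | rfl | rfl <;>
          ext <;> simp [ψ, Model.toHeisenberg, Model.single_apply]

end Stmt10
end

section
/- Let p be an odd prime and let G* be the group presented by generators x₁, x₂, y₁, y₂, z₁, z₂, t₁, ..., t₈ and relations: [x₁,x₂]=z₁, [y₁,y₂]=z₂, [z₁,x₁]=t₁, [z₁,x₂]=t₂, [z₂,y₁]=t₃, [z₂,y₂]=t₄, [x₁,y₁]=t₅, [x₁,y₂]=t₆, [x₂,y₁]=t₇, [x₂,y₂]=t₈, x₁ᵖ=x₂ᵖ=y₁ᵖ=y₂ᵖ=z₁ᵖ=z₂ᵖ=1, together with the relations declaring trivial every commutator of two generators not determined by the above (in particular t₁,...,t₈ are central and [z₁,y₁]=[z₁,y₂]=[z₂,x₁]=[z₂,x₂]=[z₁,z₂]=1). Then G* has order p¹⁴; the subgroup A generated by t₁,...,t₈ is contained in Z(G*) ∩ [G*,G*], is isomorphic to (ℤ/pℤ)⁸, and G*/A ≅ H₃((ℤ/pℤ) × (ℤ/pℤ)). Hence G* is a representation group of H₃((ℤ/pℤ) × (ℤ/pℤ)). -/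
namespace Stmt11

/-- Generators of the presented group `G*`. -/
inductive Gen
  | x1 | x2 | y1 | y2 | z1 | z2 | t1 | t2 | t3 | t4 | t5 | t6 | t7 | t8
  deriving DecidableEq

open Gen FreeGroup

/-- The commutator `[a,b] = a⁻¹b⁻¹ab`. -/
def comm (a b : FreeGroup Gen) : FreeGroup Gen := a⁻¹ * b⁻¹ * a * b

/-- The ordered pairs of generators whose commutator is specified by one of the listed
(possibly nontrivial) relations. -/
def specified : List (Gen × Gen) :=
  [(x1, x2), (y1, y2), (z1, x1), (z1, x2), (z2, y1), (z2, y2),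
   (x1, y1), (x1, y2), (x2, y1), (x2, y2)]

/-- The relators of `G*`: the listed commutator relations, the `p`-th power relations,
and trivial commutator relations for every pair of generators whose commutator is not
determined by the listed relations (in particular `t₁, …, t₈` are central and
`[z₁,y₁] = [z₁,y₂] = [z₂,x₁] = [z₂,x₂] = [z₁,z₂] = 1`). -/
def rels (p : ℕ) : Set (FreeGroup Gen) :=
  ({comm (of x1) (of x2) * (of z1)⁻¹,
    comm (of y1) (of y2) * (of z2)⁻¹,
    comm (of z1) (of x1) * (of t1)⁻¹,
    comm (of z1) (of x2) * (of t2)⁻¹,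
    comm (of z2) (of y1) * (of t3)⁻¹,
    comm (of z2) (of y2) * (of t4)⁻¹,
    comm (of x1) (of y1) * (of t5)⁻¹,
    comm (of x1) (of y2) * (of t6)⁻¹,
    comm (of x2) (of y1) * (of t7)⁻¹,
    comm (of x2) (of y2) * (of t8)⁻¹} : Set (FreeGroup Gen)) ∪
  {r | ∃ g h : Gen, r = comm (of g) (of h) ∧ (g, h) ∉ specified ∧ (h, g) ∉ specified} ∪
  ({of x1 ^ p, of x2 ^ p, of y1 ^ p, of y2 ^ p, of z1 ^ p, of z2 ^ p} :
    Set (FreeGroup Gen))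

/-- The group `G*` presented by the generators and relations above. -/
abbrev Gstar (p : ℕ) := PresentedGroup (rels p)

/-- The subgroup `A` of `G*` generated by the images of `t₁, …, t₈`. -/
def A (p : ℕ) : Subgroup (Gstar p) :=
  Subgroup.closure
    {PresentedGroup.of t1, PresentedGroup.of t2, PresentedGroup.of t3,
     PresentedGroup.of t4, PresentedGroup.of t5, PresentedGroup.of t6,
     PresentedGroup.of t7, PresentedGroup.of t8}

end Stmt11

/-- The underlying type of a nilpotent group of class three on two generators, over a
commutative ring `R`. The coordinates `a`, `b`, `c` are those of the Heisenberg group up to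
sign, and `d`, `e` are central. -/
@[ext]
structure NilThree (R : Type*) where
  a : R
  b : R
  c : R
  d : R
  e : R

namespace NilThree

variable {R : Type*} [CommRing R]

instance : Mul (NilThree R) :=
  ⟨fun x y => ⟨x.a + y.a, x.b + y.b, x.c + y.c - x.b * y.a,
    x.d + y.d + 2 * x.c * y.a - x.b * y.a ^ 2,
    x.e + y.e + 2 * (x.c - x.b * y.a) * y.b - x.b ^ 2 * y.a⟩⟩

instance : One (NilThree R) := ⟨⟨0, 0, 0, 0, 0⟩⟩

instance : Inv (NilThree R) :=
  ⟨fun x => ⟨-x.a, -x.b, -x.c - x.b * x.a,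
    -x.d + 2 * (x.c + x.b * x.a) * x.a - x.b * x.a ^ 2,
    -x.e + 2 * x.c * x.b + x.b ^ 2 * x.a⟩⟩

@[simp] lemma mul_a (x y : NilThree R) : (x * y).a = x.a + y.a := rfl
@[simp] lemma mul_b (x y : NilThree R) : (x * y).b = x.b + y.b := rfl
@[simp] lemma mul_c (x y : NilThree R) : (x * y).c = x.c + y.c - x.b * y.a := rfl
@[simp] lemma mul_d (x y : NilThree R) :
    (x * y).d = x.d + y.d + 2 * x.c * y.a - x.b * y.a ^ 2 := rfl
@[simp] lemma mul_e (x y : NilThree R) :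
    (x * y).e = x.e + y.e + 2 * (x.c - x.b * y.a) * y.b - x.b ^ 2 * y.a := rfl
@[simp] lemma one_a : (1 : NilThree R).a = 0 := rfl
@[simp] lemma one_b : (1 : NilThree R).b = 0 := rfl
@[simp] lemma one_c : (1 : NilThree R).c = 0 := rfl
@[simp] lemma one_d : (1 : NilThree R).d = 0 := rfl
@[simp] lemma one_e : (1 : NilThree R).e = 0 := rfl
@[simp] lemma inv_a (x : NilThree R) : x⁻¹.a = -x.a := rfl
@[simp] lemma inv_b (x : NilThree R) : x⁻¹.b = -x.b := rfl
@[simp] lemma inv_c (x : NilThree R) : x⁻¹.c = -x.c - x.b * x.a := rfl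
@[simp] lemma inv_d (x : NilThree R) :
    x⁻¹.d = -x.d + 2 * (x.c + x.b * x.a) * x.a - x.b * x.a ^ 2 := rfl
@[simp] lemma inv_e (x : NilThree R) :
    x⁻¹.e = -x.e + 2 * x.c * x.b + x.b ^ 2 * x.a := rfl

instance : Group (NilThree R) where
  mul_assoc x y z := by
    ext <;> simp only [mul_a, mul_b, mul_c, mul_d, mul_e] <;> ring
  one_mul x := by ext <;> simp
  mul_one x := by ext <;> simp
  inv_mul_cancel x := by
    ext <;> simp only [mul_a, mul_b, mul_c, mul_d, mul_e, inv_a, inv_b, inv_c, inv_d, inv_e,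
      one_a, one_b, one_c, one_d, one_e] <;> ring

lemma mk_a_pow (n : ℕ) : (⟨1, 0, 0, 0, 0⟩ : NilThree R) ^ n = ⟨n, 0, 0, 0, 0⟩ := by
  induction n with
  | zero => ext <;> simp
  | succ n ih => rw [pow_succ, ih]; ext <;> simp

lemma mk_b_pow (n : ℕ) : (⟨0, 1, 0, 0, 0⟩ : NilThree R) ^ n = ⟨0, n, 0, 0, 0⟩ := by
  induction n with
  | zero => ext <;> simp
  | succ n ih => rw [pow_succ, ih]; ext <;> simp

lemma mk_cde_pow (c d e : R) (n : ℕ) :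
    (⟨0, 0, c, d, e⟩ : NilThree R) ^ n = ⟨0, 0, n * c, n * d, n * e⟩ := by
  induction n with
  | zero => ext <;> simp
  | succ n ih => rw [pow_succ, ih]; ext <;> simp [add_mul]

end NilThree

/-- Pairs of elements of `NilThree R`, extended centrally by a bilinear cocycle that
records the commutators between the two factors. -/
@[ext]
structure NilPair (R : Type*) where
  l : NilThree R
  r : NilThree R
  s₁₁ : R
  s₁₂ : R
  s₂₁ : R
  s₂₂ : R

namespace NilPair

variable {R : Type*} [CommRing R]

instance : Mul (NilPair R) :=
  ⟨fun x y => ⟨x.l * y.l, x.r * y.r,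
    x.s₁₁ + y.s₁₁ - x.r.a * y.l.a, x.s₁₂ + y.s₁₂ - x.r.b * y.l.a,
    x.s₂₁ + y.s₂₁ - x.r.a * y.l.b, x.s₂₂ + y.s₂₂ - x.r.b * y.l.b⟩⟩

instance : One (NilPair R) := ⟨⟨1, 1, 0, 0, 0, 0⟩⟩

instance : Inv (NilPair R) :=
  ⟨fun x => ⟨x.l⁻¹, x.r⁻¹, -x.s₁₁ - x.r.a * x.l.a, -x.s₁₂ - x.r.b * x.l.a,
    -x.s₂₁ - x.r.a * x.l.b, -x.s₂₂ - x.r.b * x.l.b⟩⟩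

@[simp] lemma mul_l (x y : NilPair R) : (x * y).l = x.l * y.l := rfl
@[simp] lemma mul_r (x y : NilPair R) : (x * y).r = x.r * y.r := rfl
@[simp] lemma mul_s₁₁ (x y : NilPair R) :
    (x * y).s₁₁ = x.s₁₁ + y.s₁₁ - x.r.a * y.l.a := rfl
@[simp] lemma mul_s₁₂ (x y : NilPair R) :
    (x * y).s₁₂ = x.s₁₂ + y.s₁₂ - x.r.b * y.l.a := rfl
@[simp] lemma mul_s₂₁ (x y : NilPair R) :
    (x * y).s₂₁ = x.s₂₁ + y.s₂₁ - x.r.a * y.l.b := rfl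
@[simp] lemma mul_s₂₂ (x y : NilPair R) :
    (x * y).s₂₂ = x.s₂₂ + y.s₂₂ - x.r.b * y.l.b := rfl
@[simp] lemma one_l : (1 : NilPair R).l = 1 := rfl
@[simp] lemma one_r : (1 : NilPair R).r = 1 := rfl
@[simp] lemma one_s₁₁ : (1 : NilPair R).s₁₁ = 0 := rfl
@[simp] lemma one_s₁₂ : (1 : NilPair R).s₁₂ = 0 := rfl
@[simp] lemma one_s₂₁ : (1 : NilPair R).s₂₁ = 0 := rfl
@[simp] lemma one_s₂₂ : (1 : NilPair R).s₂₂ = 0 := rfl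
@[simp] lemma inv_l (x : NilPair R) : x⁻¹.l = x.l⁻¹ := rfl
@[simp] lemma inv_r (x : NilPair R) : x⁻¹.r = x.r⁻¹ := rfl
@[simp] lemma inv_s₁₁ (x : NilPair R) : x⁻¹.s₁₁ = -x.s₁₁ - x.r.a * x.l.a := rfl
@[simp] lemma inv_s₁₂ (x : NilPair R) : x⁻¹.s₁₂ = -x.s₁₂ - x.r.b * x.l.a := rfl
@[simp] lemma inv_s₂₁ (x : NilPair R) : x⁻¹.s₂₁ = -x.s₂₁ - x.r.a * x.l.b := rfl
@[simp] lemma inv_s₂₂ (x : NilPair R) : x⁻¹.s₂₂ = -x.s₂₂ - x.r.b * x.l.b := rfl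

instance : Group (NilPair R) where
  mul_assoc x y z := by
    apply NilPair.ext <;> simp [mul_assoc] <;> ring
  one_mul x := by apply NilPair.ext <;> simp
  mul_one x := by apply NilPair.ext <;> simp
  inv_mul_cancel x := by apply NilPair.ext <;> simp <;> ring

/-- The inclusion of the first factor. -/
@[simps]
def inl : NilThree R →* NilPair R where
  toFun x := ⟨x, 1, 0, 0, 0, 0⟩
  map_one' := rfl
  map_mul' x y := by apply NilPair.ext <;> simp

/-- The inclusion of the second factor. -/
@[simps]
def inr : NilThree R →* NilPair R where
  toFun x := ⟨1, x, 0, 0, 0, 0⟩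
  map_one' := rfl
  map_mul' x y := by apply NilPair.ext <;> simp

lemma mk_s_pow (s₁₁ s₁₂ s₂₁ s₂₂ : R) (n : ℕ) :
    (⟨1, 1, s₁₁, s₁₂, s₂₁, s₂₂⟩ : NilPair R) ^ n =
      ⟨1, 1, n * s₁₁, n * s₁₂, n * s₂₁, n * s₂₂⟩ := by
  induction n with
  | zero => apply NilPair.ext <;> simp
  | succ n ih => rw [pow_succ, ih]; apply NilPair.ext <;> simp [add_mul]

/-- Forgetting the central coordinates. -/
@[simps]
def toHeisenberg : NilPair R →* Heisenberg (R × R) where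
  toFun x := ⟨(x.l.a, x.r.a), (x.l.b, x.r.b), (-x.l.c, -x.r.c)⟩
  map_one' := by ext <;> simp
  map_mul' x y := by ext <;> simp <;> ring

end NilPair

section Collection

variable {G : Type*} [Group G]

lemma inv_mul_inv_mul_mul_eq_iff {a b c : G} : a⁻¹ * b⁻¹ * a * b = c ↔ a * b = b * a * c := by
  rw [← mul_right_inj (b * a)]
  simp [mul_assoc]

lemma pow_mul_eq_mul_pow_mul_pow {x y z : G} (h : x * y = y * x * z) (hx : Commute x z) (n : ℕ) :
    x ^ n * y = y * x ^ n * z ^ n := by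
  have h' : SemiconjBy y (x * z) x := by rw [SemiconjBy, ← mul_assoc, ← h]
  rw [mul_assoc, ← hx.mul_pow]
  exact (h'.pow_right n).symm

lemma pow_eq_one_of_mul_eq {x y z : G} (h : x * y = y * x * z) (hx : Commute x z) {n : ℕ}
    (hn : x ^ n = 1) : z ^ n = 1 := by
  simpa [hn] using pow_mul_eq_mul_pow_mul_pow h hx n

lemma pow_val_add {p : ℕ} [NeZero p] {g : G} (hg : g ^ p = 1) (a b : ZMod p) :
    g ^ (a + b).val = g ^ a.val * g ^ b.val := by
  rw [← pow_add, ZMod.val_add, ← pow_eq_pow_mod _ hg]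

lemma pow_eq_one_of_natCast_eq_zero {p : ℕ} {g : G} (hg : g ^ p = 1) {n : ℕ}
    (hn : (n : ZMod p) = 0) : g ^ n = 1 := by
  obtain ⟨k, rfl⟩ := (ZMod.natCast_eq_zero_iff n p).1 hn
  rw [pow_mul, hg, one_pow]

/-- Collection in a group of class two and finite exponent generated by two elements. -/
lemma exists_eq_pow_mul_pow_mul_pow {x y z : G} (h : x * y = y * x * z) (hx : Commute x z)
    (hy : Commute y z) {p : ℕ} (hp : 0 < p) (hxp : x ^ p = 1) (hyp : y ^ p = 1) (hzp : z ^ p = 1)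
    {g : G} (hg : g ∈ Subgroup.closure {x, y, z}) :
    ∃ a b c : ℕ, g = y ^ b * x ^ a * z ^ c := by
  have step : ∀ w ∈ ({x, y, z} : Set G), ∀ g : G, (∃ a b c : ℕ, g = y ^ b * x ^ a * z ^ c) →
      ∃ a b c : ℕ, g * w = y ^ b * x ^ a * z ^ c := by
    rintro w (rfl | rfl | rfl) _ ⟨a, b, c, rfl⟩
    · exact ⟨a + 1, b, c, by rw [mul_assoc, ← (hx.pow_right c).eq]; simp [pow_succ, mul_assoc]⟩
    · refine ⟨a, b + 1, a + c, ?_⟩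
      rw [mul_assoc, ← (hy.pow_right c).eq, mul_assoc, ← mul_assoc (x ^ a),
        pow_mul_eq_mul_pow_mul_pow h hx]
      simp [pow_succ, pow_add, mul_assoc]
    · exact ⟨a, b, c + 1, by rw [pow_succ, mul_assoc _ (w ^ c)]⟩
  have hinv : ∀ w ∈ ({x, y, z} : Set G), w⁻¹ = w ^ (p - 1) := by
    intro w hw
    have hwp : w ^ p = 1 := by
      rcases hw with rfl | rfl | rfl <;> assumption
    rw [inv_eq_iff_mul_eq_one, mul_pow_sub_one hp.ne', hwp]
  induction hg using Subgroup.closure_induction_right with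
  | one => exact ⟨0, 0, 0, by simp⟩
  | mul_right g _ w hw ih => exact step w hw g ih
  | mul_inv_cancel g _ w hw ih =>
    rw [hinv w hw]
    generalize p - 1 = n
    induction n with
    | zero => simpa using ih
    | succ n ihn => rw [pow_succ, ← mul_assoc]; exact step w hw _ ihn

end Collection

namespace Stmt11

open Gen
open FreeGroup (of)
open scoped IsMulCommutative

/-- The images in `NilPair R` of the generators of `G*`. -/
def genImage (R : Type*) [CommRing R] : Gen → NilPair R
  | x1 => .inl ⟨1, 0, 0, 0, 0⟩
  | x2 => .inl ⟨0, 1, 0, 0, 0⟩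
  | y1 => .inr ⟨1, 0, 0, 0, 0⟩
  | y2 => .inr ⟨0, 1, 0, 0, 0⟩
  | z1 => .inl ⟨0, 0, 1, 1, 1⟩
  | z2 => .inr ⟨0, 0, 1, 1, 1⟩
  | t1 => .inl ⟨0, 0, 0, 2, 0⟩
  | t2 => .inl ⟨0, 0, 0, 0, 2⟩
  | t3 => .inr ⟨0, 0, 0, 2, 0⟩
  | t4 => .inr ⟨0, 0, 0, 0, 2⟩
  | t5 => ⟨1, 1, 1, 0, 0, 0⟩
  | t6 => ⟨1, 1, 0, 1, 0, 0⟩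
  | t7 => ⟨1, 1, 0, 0, 1, 0⟩
  | t8 => ⟨1, 1, 0, 0, 0, 1⟩

lemma genImage_commute (R : Type*) [CommRing R] (g h : Gen) (hgh : (g, h) ∉ specified)
    (hhg : (h, g) ∉ specified) : Commute (genImage R g) (genImage R h) := by
  cases g <;> cases h <;> first
    | exact Commute.refl _
    | (refine absurd ?_ hgh; decide)
    | (refine absurd ?_ hhg; decide)
    | (apply NilPair.ext <;> simp [genImage, NilThree.ext_iff] <;> ring)

lemma genImage_pow (R : Type*) [CommRing R] (p : ℕ) [CharP R p] (g : Gen) :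
    genImage R g ^ p = 1 := by
  cases g <;> simp only [genImage, ← map_pow, NilThree.mk_a_pow, NilThree.mk_b_pow,
    NilThree.mk_cde_pow, NilPair.mk_s_pow, CharP.cast_eq_zero, zero_mul] <;> rfl

lemma lift_genImage_eq_one (p : ℕ) : ∀ r ∈ rels p, FreeGroup.lift (genImage (ZMod p)) r = 1 := by
  rintro r ((hr | ⟨g, h, rfl, hgh, hhg⟩) | hr)
  · simp only [Set.mem_insert_iff, Set.mem_singleton_iff] at hr
    rcases hr with rfl | rfl | rfl | rfl | rfl | rfl | rfl | rfl | rfl | rfl <;>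
    · simp only [comm, map_mul, map_inv, FreeGroup.lift_apply_of, mul_inv_eq_one,
        inv_mul_inv_mul_mul_eq_iff]
      apply NilPair.ext <;> simp [genImage, NilThree.ext_iff]
  · simp only [comm, map_mul, map_inv, FreeGroup.lift_apply_of, inv_mul_inv_mul_mul_eq_iff, mul_one]
    exact genImage_commute _ g h hgh hhg
  · simp only [Set.mem_insert_iff, Set.mem_singleton_iff] at hr
    rcases hr with rfl | rfl | rfl | rfl | rfl | rfl <;>
      rw [map_pow, FreeGroup.lift_apply_of, genImage_pow]

/-- The homomorphism from `G*` to its polynomial model. -/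
def toNilPair (p : ℕ) : Gstar p →* NilPair (ZMod p) :=
  PresentedGroup.toGroup (lift_genImage_eq_one p)

@[simp]
lemma toNilPair_of (p : ℕ) (g : Gen) :
    toNilPair p (PresentedGroup.of g) = genImage (ZMod p) g :=
  PresentedGroup.toGroup.of _

section Relations

variable {p : ℕ}

lemma comm_mem_rels {g h k : Gen} (hg : (g, h, k) ∈ [(x1, x2, z1), (y1, y2, z2), (z1, x1, t1),
    (z1, x2, t2), (z2, y1, t3), (z2, y2, t4), (x1, y1, t5), (x1, y2, t6), (x2, y1, t7),
    (x2, y2, t8)]) : comm (of g) (of h) * (of k)⁻¹ ∈ rels p := by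
  refine Or.inl (Or.inl ?_)
  simp only [List.mem_cons, List.not_mem_nil, Prod.mk.injEq, or_false] at hg
  rcases hg with ⟨rfl, rfl, rfl⟩ | ⟨rfl, rfl, rfl⟩ | ⟨rfl, rfl, rfl⟩ | ⟨rfl, rfl, rfl⟩ |
    ⟨rfl, rfl, rfl⟩ | ⟨rfl, rfl, rfl⟩ | ⟨rfl, rfl, rfl⟩ | ⟨rfl, rfl, rfl⟩ | ⟨rfl, rfl, rfl⟩ |
    ⟨rfl, rfl, rfl⟩ <;>
  simp only [Set.mem_insert_iff, Set.mem_singleton_iff, true_or, or_true]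

lemma pow_mem_rels {g : Gen} (hg : g ∈ [x1, x2, y1, y2, z1, z2]) : of g ^ p ∈ rels p := by
  refine Or.inr ?_
  simp only [List.mem_cons, List.not_mem_nil, or_false] at hg
  rcases hg with rfl | rfl | rfl | rfl | rfl | rfl <;>
  simp only [Set.mem_insert_iff, Set.mem_singleton_iff, true_or, or_true]

lemma of_mul_of {g h k : Gen} (hr : comm (of g) (of h) * (of k)⁻¹ ∈ rels p) :
    (PresentedGroup.of g * PresentedGroup.of h : Gstar p) =
      PresentedGroup.of h * PresentedGroup.of g * PresentedGroup.of k :=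
  inv_mul_inv_mul_mul_eq_iff.1 (PresentedGroup.mk_eq_mk_of_mul_inv_mem hr)

lemma commute_of {g h : Gen} (hgh : (g, h) ∉ specified) (hhg : (h, g) ∉ specified) :
    Commute (PresentedGroup.of g : Gstar p) (PresentedGroup.of h) := by
  have hr : comm (of g) (of h) ∈ rels p := Or.inl (Or.inr ⟨g, h, rfl, hgh, hhg⟩)
  have h1 := PresentedGroup.one_of_mem hr
  rw [comm, map_mul, map_mul, map_mul, map_inv, map_inv, inv_mul_inv_mul_mul_eq_iff, mul_one] at h1
  exact h1

lemma of_pow {g : Gen} (hr : of g ^ p ∈ rels p) : (PresentedGroup.of g ^ p : Gstar p) = 1 :=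
  (map_pow (PresentedGroup.mk (rels p)) _ _).symm.trans (PresentedGroup.one_of_mem hr)

/-- The central generators `t₁, …, t₈`. -/
def centralGen : Fin 8 → Gen := ![t1, t2, t3, t4, t5, t6, t7, t8]

lemma A_eq_closure_range :
    A p = Subgroup.closure (Set.range fun i => (PresentedGroup.of (centralGen i) : Gstar p)) := by
  rw [A]
  congr 1
  ext g
  simp [Fin.exists_fin_succ, centralGen, eq_comm]

lemma of_centralGen_mem_A (i : Fin 8) : (PresentedGroup.of (centralGen i) : Gstar p) ∈ A p := by
  rw [A_eq_closure_range]
  exact Subgroup.subset_closure ⟨i, rfl⟩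

lemma of_centralGen_mem_center (i : Fin 8) :
    (PresentedGroup.of (centralGen i) : Gstar p) ∈ Subgroup.center (Gstar p) := by
  have : Subgroup.centralizer {(PresentedGroup.of (centralGen i) : Gstar p)} = ⊤ := by
    refine (Subgroup.eq_top_iff' _).2 (PresentedGroup.generated_by _ _ fun h => ?_)
    rw [Subgroup.mem_centralizer_singleton_iff]
    refine (commute_of ?_ ?_).eq <;> fin_cases i <;> cases h <;> simp [specified, centralGen]
  exact Subgroup.mem_center_iff.2 fun g =>
    Subgroup.mem_centralizer_singleton_iff.1 (this ▸ Subgroup.mem_top g)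

lemma exists_of_mul_of_eq_centralGen (i : Fin 8) : ∃ g h : Gen,
    (PresentedGroup.of g ^ p : Gstar p) = 1 ∧
    (PresentedGroup.of g * PresentedGroup.of h : Gstar p) =
      PresentedGroup.of h * PresentedGroup.of g * PresentedGroup.of (centralGen i) := by
  let l : Fin 8 → Gen × Gen :=
    ![(z1, x1), (z1, x2), (z2, y1), (z2, y2), (x1, y1), (x1, y2), (x2, y1), (x2, y2)]
  have h₁ : of (l i).1 ^ p ∈ rels p := pow_mem_rels (by fin_cases i <;> simp [l])
  have h₂ : comm (of (l i).1) (of (l i).2) * (of (centralGen i))⁻¹ ∈ rels p :=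
    comm_mem_rels (by fin_cases i <;> simp [l, centralGen])
  exact ⟨_, _, of_pow h₁, of_mul_of h₂⟩

lemma of_centralGen_pow (i : Fin 8) : (PresentedGroup.of (centralGen i) ^ p : Gstar p) = 1 := by
  obtain ⟨g, h, hg, hgh⟩ := exists_of_mul_of_eq_centralGen (p := p) i
  exact pow_eq_one_of_mul_eq hgh (Subgroup.mem_center_iff.1 (of_centralGen_mem_center i) _) hg

lemma A_le_center : A p ≤ Subgroup.center (Gstar p) := by
  rw [A_eq_closure_range, Subgroup.closure_le]
  rintro _ ⟨i, rfl⟩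
  exact of_centralGen_mem_center i

lemma A_le_commutator : A p ≤ commutator (Gstar p) := by
  rw [A_eq_closure_range, Subgroup.closure_le]
  rintro _ ⟨i, rfl⟩
  obtain ⟨g, h, -, hgh⟩ := exists_of_mul_of_eq_centralGen (p := p) i
  have := Subgroup.commutator_mem_commutator (Subgroup.mem_top (PresentedGroup.of g : Gstar p)⁻¹)
    (Subgroup.mem_top (PresentedGroup.of h : Gstar p)⁻¹)
  rwa [commutatorElement_def, inv_inv, inv_inv, inv_mul_inv_mul_mul_eq_iff.2 hgh] at this

end Relations

/-- The central embedding of `(ℤ/pℤ)⁸` in `G*` with coordinates `t₁, …, t₈`. -/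
def centralHom (p : ℕ) [NeZero p] :
    Multiplicative (Fin 8 → ZMod p) →* Subgroup.center (Gstar p) where
  toFun v := ∏ i, (⟨_, of_centralGen_mem_center i⟩ : Subgroup.center (Gstar p)) ^ (v.toAdd i).val
  map_one' := by simp
  map_mul' v w := by
    rw [← Finset.prod_mul_distrib]
    refine Finset.prod_congr rfl fun i _ => pow_val_add ?_ _ _
    exact Subtype.ext (of_centralGen_pow i)

lemma toNilPair_centralHom {p : ℕ} [NeZero p] (v : Multiplicative (Fin 8 → ZMod p)) :
    toNilPair p (centralHom p v) =
      ⟨⟨0, 0, 0, v.toAdd 0 * 2, v.toAdd 1 * 2⟩, ⟨0, 0, 0, v.toAdd 2 * 2, v.toAdd 3 * 2⟩,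
        v.toAdd 4, v.toAdd 5, v.toAdd 6, v.toAdd 7⟩ := by
  simp only [centralHom, MonoidHom.coe_mk, OneHom.coe_mk, Fin.prod_univ_eight, Subgroup.coe_mul,
    Subgroup.coe_pow, map_mul, map_pow, toNilPair_of, centralGen, Matrix.cons_val, genImage]
  simp only [← map_pow, NilThree.mk_cde_pow, NilPair.mk_s_pow]
  apply NilPair.ext <;> simp [NilThree.ext_iff]

lemma centralHom_injective {p : ℕ} [Fact p.Prime] (hodd : Odd p) :
    Function.Injective ((Subgroup.center (Gstar p)).subtype.comp (centralHom p)) := by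
  have h2 : (2 : ZMod p) ≠ 0 := by
    intro h
    have h' : p ∣ 2 := (ZMod.natCast_eq_zero_iff 2 p).1 (by exact_mod_cast h)
    have := (Nat.prime_dvd_prime_iff_eq Fact.out Nat.prime_two).1 h'
    subst this
    exact absurd hodd (by decide)
  rw [injective_iff_map_eq_one]
  intro v hv
  have h := toNilPair_centralHom v
  rw [show (centralHom p v : Gstar p) = 1 from hv, map_one] at h
  simp only [NilPair.ext_iff, NilThree.ext_iff, NilPair.one_l, NilPair.one_r, NilThree.one_a,
    NilThree.one_b, NilThree.one_c, NilThree.one_d, NilThree.one_e, NilPair.one_s₁₁,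
    NilPair.one_s₁₂, NilPair.one_s₂₁, NilPair.one_s₂₂, eq_comm (a := (0 : ZMod p)), mul_eq_zero,
    h2, or_false, true_and] at h
  apply Multiplicative.toAdd.injective
  ext i
  fin_cases i <;> simp_all

lemma range_centralHom (p : ℕ) [Fact p.Prime] :
    ((Subgroup.center (Gstar p)).subtype.comp (centralHom p)).range = A p := by
  apply le_antisymm
  · rintro _ ⟨v, rfl⟩
    simp only [centralHom, MonoidHom.comp_apply, MonoidHom.coe_mk, OneHom.coe_mk,
      Subgroup.subtype_apply]
    rw [← Subgroup.subtype_apply, ← Subgroup.mem_comap]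
    exact prod_mem fun i _ => pow_mem (of_centralGen_mem_A i) _
  · rw [A_eq_closure_range, Subgroup.closure_le]
    rintro _ ⟨i, rfl⟩
    refine ⟨.ofAdd (Pi.single i 1), ?_⟩
    change ((centralHom p _ : Subgroup.center (Gstar p)) : Gstar p) = _
    rw [centralHom, MonoidHom.coe_mk, OneHom.coe_mk, Finset.prod_eq_single i]
    · simp [ZMod.val_one]
    · intro j _ hj
      simp [hj]
    · simp

/-- The quotient map from `G*` to the Heisenberg group. -/
def toHeisenberg (p : ℕ) : Gstar p →* Heisenberg (ZMod p × ZMod p) :=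
  NilPair.toHeisenberg.comp (toNilPair p)

lemma A_le_ker_toHeisenberg (p : ℕ) : A p ≤ (toHeisenberg p).ker := by
  rw [A_eq_closure_range, Subgroup.closure_le]
  rintro _ ⟨i, rfl⟩
  rw [SetLike.mem_coe, MonoidHom.mem_ker]
  fin_cases i <;> simp [toHeisenberg, centralGen, genImage] <;> ext <;> simp

/-- A set of representatives for the cosets of `A` in `G*`. -/
def collected {G : Type*} [Group G] (v : Gen → G) (a₁ b₁ c₁ a₂ b₂ c₂ : ℕ) : G :=
  v x2 ^ b₁ * v x1 ^ a₁ * v z1 ^ c₁ * (v y2 ^ b₂ * v y1 ^ a₂ * v z2 ^ c₂)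

lemma toHeisenberg_collected (p : ℕ) (a₁ b₁ c₁ a₂ b₂ c₂ : ℕ) :
    toHeisenberg p (collected PresentedGroup.of a₁ b₁ c₁ a₂ b₂ c₂) =
      ⟨(a₁, a₂), (b₁, b₂), (b₁ * a₁ - c₁, b₂ * a₂ - c₂)⟩ := by
  simp only [toHeisenberg, collected, MonoidHom.comp_apply, map_mul, map_pow, toNilPair_of,
    genImage]
  simp only [← map_pow, NilThree.mk_a_pow, NilThree.mk_b_pow, NilThree.mk_cde_pow]
  ext <;> simp [sub_eq_add_neg, add_comm]

lemma exists_mk_eq_collected {p : ℕ} [NeZero p] [(A p).Normal] (g : Gstar p) :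
    ∃ a₁ b₁ c₁ a₂ b₂ c₂ : ℕ, (QuotientGroup.mk' (A p)) g =
      QuotientGroup.mk' (A p) (collected PresentedGroup.of a₁ b₁ c₁ a₂ b₂ c₂) := by
  set q := QuotientGroup.mk' (A p)
  let v : Gen → Gstar p ⧸ A p := fun g => q (PresentedGroup.of g)
  have hv {g h k : Gen} (hr : comm (of g) (of h) * (of k)⁻¹ ∈ rels p) :
      v g * v h = v h * v g * v k := by
    simpa using congrArg q (of_mul_of hr)
  have hc (g h : Gen) (hgh : (g, h) ∉ specified) (hhg : (h, g) ∉ specified) :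
      Commute (v g) (v h) := (commute_of hgh hhg).map q
  have ht (i : Fin 8) : v (centralGen i) = 1 :=
    (QuotientGroup.eq_one_iff _).2 (of_centralGen_mem_A i)
  have hcomm {g h : Gen} (i : Fin 8)
      (hr : comm (of g) (of h) * (of (centralGen i))⁻¹ ∈ rels p) : Commute (v g) (v h) := by
    have h1 := hv hr
    rwa [ht, mul_one] at h1
  have hpow (g : Gen) (hr : of g ^ p ∈ rels p) : v g ^ p = 1 := by
    simpa using congrArg q (of_pow hr)
  let H₁ := Subgroup.closure {v x1, v x2, v z1}
  let H₂ := Subgroup.closure {v y1, v y2, v z2}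
  have hH : H₁ ≤ Subgroup.centralizer H₂ := by
    rw [Subgroup.centralizer_closure, Subgroup.closure_le]
    rintro w hw u hu
    revert u w
    have h11 : Commute (v x1) (v y1) := hcomm 4 (comm_mem_rels (by simp [centralGen]))
    have h12 : Commute (v x1) (v y2) := hcomm 5 (comm_mem_rels (by simp [centralGen]))
    have h21 : Commute (v x2) (v y1) := hcomm 6 (comm_mem_rels (by simp [centralGen]))
    have h22 : Commute (v x2) (v y2) := hcomm 7 (comm_mem_rels (by simp [centralGen]))
    rintro w (rfl | rfl | rfl) u (rfl | rfl | rfl) <;> first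
      | exact h11.symm
      | exact h12.symm
      | exact h21.symm
      | exact h22.symm
      | exact hc _ _ (by simp [specified]) (by simp [specified])
  have hcom (h₁ : H₁) (h₂ : H₂) : Commute (H₁.subtype h₁) (H₂.subtype h₂) :=
    (hH h₁.2 h₂ h₂.2).symm
  have htop : q g ∈ H₁ ⊔ H₂ := by
    refine PresentedGroup.generated_by _ ((H₁ ⊔ H₂).comap q) (fun j => ?_) g
    have hl : ({v x1, v x2, v z1} : Set _) ⊆ (H₁ ⊔ H₂ : Subgroup _) :=
      (Subgroup.closure_le _).1 le_sup_left
    have hr : ({v y1, v y2, v z2} : Set _) ⊆ (H₁ ⊔ H₂ : Subgroup _) :=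
      (Subgroup.closure_le _).1 le_sup_right
    have hone (i : Fin 8) : v (centralGen i) ∈ H₁ ⊔ H₂ := by rw [ht]; exact one_mem _
    cases j
    case x1 | x2 | z1 => exact hl (by simp [v])
    case y1 | y2 | z2 => exact hr (by simp [v])
    case t1 => exact hone 0
    case t2 => exact hone 1
    case t3 => exact hone 2
    case t4 => exact hone 3
    case t5 => exact hone 4
    case t6 => exact hone 5
    case t7 => exact hone 6
    case t8 => exact hone 7
  rw [← H₁.range_subtype, ← H₂.range_subtype, ← MonoidHom.noncommCoprod_range _ _ hcom] at htop
  obtain ⟨⟨⟨h₁, hh₁⟩, ⟨h₂, hh₂⟩⟩, hg⟩ := htop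
  obtain ⟨a₁, b₁, c₁, rfl⟩ := exists_eq_pow_mul_pow_mul_pow (hv (comm_mem_rels (by simp)))
    (hcomm 0 (comm_mem_rels (by simp [centralGen]))).symm
    (hcomm 1 (comm_mem_rels (by simp [centralGen]))).symm
    (NeZero.pos p) (hpow _ (pow_mem_rels (by simp))) (hpow _ (pow_mem_rels (by simp)))
    (hpow _ (pow_mem_rels (by simp))) hh₁
  obtain ⟨a₂, b₂, c₂, rfl⟩ := exists_eq_pow_mul_pow_mul_pow (hv (comm_mem_rels (by simp)))
    (hcomm 2 (comm_mem_rels (by simp [centralGen]))).symm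
    (hcomm 3 (comm_mem_rels (by simp [centralGen]))).symm
    (NeZero.pos p) (hpow _ (pow_mem_rels (by simp))) (hpow _ (pow_mem_rels (by simp)))
    (hpow _ (pow_mem_rels (by simp))) hh₂
  refine ⟨a₁, b₁, c₁, a₂, b₂, c₂, hg.symm.trans ?_⟩
  simp [collected, v]

lemma ker_toHeisenberg (p : ℕ) [NeZero p] : (toHeisenberg p).ker = A p := by
  refine le_antisymm (fun g hg => ?_) (A_le_ker_toHeisenberg p)
  have : (A p).Normal := ⟨fun a ha g => by
    rwa [Subgroup.mem_center_iff.1 (A_le_center ha) g, mul_inv_cancel_right]⟩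
  obtain ⟨a₁, b₁, c₁, a₂, b₂, c₂, h⟩ := exists_mk_eq_collected g
  have hmem := (QuotientGroup.eq (s := A p)).1 h
  have hφ := A_le_ker_toHeisenberg p hmem
  rw [MonoidHom.mem_ker, map_mul, map_inv, MonoidHom.mem_ker.1 hg, inv_one, one_mul,
    toHeisenberg_collected] at hφ
  simp only [Heisenberg.ext_iff, Heisenberg.one_a, Heisenberg.one_b, Heisenberg.one_c,
    Prod.mk_eq_zero] at hφ
  obtain ⟨⟨ha₁, ha₂⟩, ⟨hb₁, hb₂⟩, hc₁, hc₂⟩ := hφ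
  rw [ha₁, mul_zero, zero_sub, neg_eq_zero] at hc₁
  rw [ha₂, mul_zero, zero_sub, neg_eq_zero] at hc₂
  have hpow (g : Gen) (hr : of g ^ p ∈ rels p) {n : ℕ} (hn : (n : ZMod p) = 0) :
      (PresentedGroup.of g : Gstar p) ^ n = 1 :=
    pow_eq_one_of_natCast_eq_zero (of_pow hr) hn
  rw [collected, hpow x1 (pow_mem_rels (by simp)) ha₁, hpow x2 (pow_mem_rels (by simp)) hb₁,
    hpow z1 (pow_mem_rels (by simp)) hc₁, hpow y1 (pow_mem_rels (by simp)) ha₂,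
    hpow y2 (pow_mem_rels (by simp)) hb₂, hpow z2 (pow_mem_rels (by simp)) hc₂] at hmem
  simpa using hmem

lemma toHeisenberg_surjective (p : ℕ) [NeZero p] : Function.Surjective (toHeisenberg p) := by
  rintro ⟨⟨a₁, a₂⟩, ⟨b₁, b₂⟩, ⟨c₁, c₂⟩⟩
  refine ⟨_, (toHeisenberg_collected p a₁.val b₁.val (b₁ * a₁ - c₁).val a₂.val b₂.val
    (b₂ * a₂ - c₂).val).trans ?_⟩
  simp

lemma card_heisenberg (R : Type*) [CommRing R] : Nat.card (Heisenberg R) = Nat.card R ^ 3 := by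
  let e : Heisenberg R ≃ R × R × R :=
    { toFun x := (x.a, x.b, x.c)
      invFun x := ⟨x.1, x.2.1, x.2.2⟩
      left_inv _ := rfl
      right_inv _ := rfl }
  rw [Nat.card_congr e, Nat.card_prod, Nat.card_prod]
  ring

/-- For an odd prime `p`, the presented group `G*` has order `p¹⁴`, the subgroup `A`
generated by `t₁, …, t₈` is contained in `Z(G*) ∩ [G*,G*]`, is isomorphic to `(ℤ/pℤ)⁸`,
and `G*/A ≅ H₃((ℤ/pℤ) × (ℤ/pℤ))` (expressed via a surjective homomorphism with kernel
`A`).  Hence `G*` is a representation group of `H₃((ℤ/pℤ) × (ℤ/pℤ))`. -/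
theorem Gstar_is_representation_group (p : ℕ) [Fact p.Prime] (hodd : Odd p) :
    Nat.card (Gstar p) = p ^ 14 ∧
    A p ≤ Subgroup.center (Gstar p) ⊓ commutator (Gstar p) ∧
    Nonempty (A p ≃* Multiplicative (Fin 8 → ZMod p)) ∧
    ∃ φ : Gstar p →* Heisenberg (ZMod p × ZMod p),
      Function.Surjective φ ∧ φ.ker = A p := by
  have e : Multiplicative (Fin 8 → ZMod p) ≃* A p :=
    (MonoidHom.ofInjective (centralHom_injective hodd)).trans
      (MulEquiv.subgroupCongr (range_centralHom p))
  refine ⟨?_, le_inf A_le_center A_le_commutator, ⟨e.symm⟩, toHeisenberg p,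
    toHeisenberg_surjective p, ker_toHeisenberg p⟩
  have hA : Nat.card (A p) = p ^ 8 := by
    rw [← Nat.card_congr e.toEquiv, Nat.card_congr Multiplicative.toAdd]
    simp
  rw [Subgroup.card_eq_card_quotient_mul_card_subgroup (toHeisenberg p).ker,
    Nat.card_congr (QuotientGroup.quotientKerEquivOfSurjective _
      (toHeisenberg_surjective p)).toEquiv, card_heisenberg, ker_toHeisenberg, hA,
    Nat.card_prod, Nat.card_zmod]
  ring

end Stmt11
end
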